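/- arXiv:0812.0872 — 3 statements merged into one kernel-verified Lean document; each statement's English description precedes it below -/
import Mathlib

section
/- Let c > 4 be a fixed constant. Then almost surely every rigid component of the Erdős–Rényi random graph G(n, c/n) that spans at least 4 vertices spans at least n/10 vertices, and at least one such component exists. -/
open MeasureTheory Filter

noncomputable instance {n : ℕ} : MeasurableSpace (SimpleGraph (Fin n)) := ⊤

/-- The Bernoulli(p) measure on `Bool`. -/
noncomputable def bernoulliMeasure (p : ℝ) : Measure Bool :=
  ENNReal.ofReal p • Measure.dirac true + ENNReal.ofReal (1 - p) • Measure.dirac false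

/-- The Erdős–Rényi measure on simple graphs on `Fin n`: the pushforward to
`SimpleGraph (Fin n)` of the product Bernoulli(p) measure over unordered pairs
of distinct vertices. -/
noncomputable def erdosRenyi (n : ℕ) (p : ℝ) : Measure (SimpleGraph (Fin n)) :=
  Measure.map
    (fun f : ({e : Sym2 (Fin n) // ¬ e.IsDiag} → Bool) =>
      SimpleGraph.fromEdgeSet {e : Sym2 (Fin n) | ∃ h : ¬ e.IsDiag, f ⟨e, h⟩ = true})
    (Measure.pi fun _ => bernoulliMeasure p)

/-- The edges of `G` spanned by the vertex set `S`. -/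
def spannedEdges {n : ℕ} (G : SimpleGraph (Fin n)) (S : Finset (Fin n)) : Set (Sym2 (Fin n)) :=
  {e | e ∈ G.edgeSet ∧ ∀ v ∈ e, v ∈ S}

/-- `H` is a (2,3)-tight (Laman) graph on the vertex set `S`: all edges of `H` lie
inside `S`, every subset `T ⊆ S` with `|T| ≥ 2` spans at most `2|T| - 3` edges, and
`H` has exactly `2|S| - 3` edges. -/
def IsTightOn {n : ℕ} (H : SimpleGraph (Fin n)) (S : Finset (Fin n)) : Prop :=
  (∀ e ∈ H.edgeSet, ∀ v ∈ e, v ∈ S) ∧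
  (∀ T : Finset (Fin n), T ⊆ S → 2 ≤ T.card →
    (spannedEdges H T).ncard ≤ 2 * T.card - 3) ∧
  H.edgeSet.ncard = 2 * S.card - 3

/-- The induced subgraph `G[S]` is rigid: it contains a spanning (2,3)-tight subgraph. -/
def IsRigidOn {n : ℕ} (G : SimpleGraph (Fin n)) (S : Finset (Fin n)) : Prop :=
  ∃ H ≤ G, IsTightOn H S

/-- `S` is a rigid component of `G`: `|S| ≥ 2`, `G[S]` is rigid, and `S` is
inclusion-wise maximal with this property. -/
def IsRigidComponent {n : ℕ} (G : SimpleGraph (Fin n)) (S : Finset (Fin n)) : Prop :=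
  2 ≤ S.card ∧ IsRigidOn G S ∧
  ∀ S' : Finset (Fin n), S ⊆ S' → IsRigidOn G S' → S' = S

section Cylinder

variable {n : ℕ} {p : ℝ}

lemma isProbabilityMeasure_bernoulliMeasure (h0 : 0 ≤ p) (h1 : p ≤ 1) :
    IsProbabilityMeasure (bernoulliMeasure p) := by
  constructor
  simp [bernoulliMeasure, ← ENNReal.ofReal_add h0 (sub_nonneg.2 h1)]

lemma isProbabilityMeasure_erdosRenyi (h0 : 0 ≤ p) (h1 : p ≤ 1) :
    IsProbabilityMeasure (erdosRenyi n p) := by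
  have := isProbabilityMeasure_bernoulliMeasure h0 h1
  exact Measure.isProbabilityMeasure_map (measurable_of_finite _).aemeasurable

/-- The event that all edges of `A` and no edges of `B` are present. -/
def cylinderEvent (A B : Finset (Sym2 (Fin n))) : Set (SimpleGraph (Fin n)) :=
  {G | (∀ e ∈ A, e ∈ G.edgeSet) ∧ ∀ e ∈ B, e ∉ G.edgeSet}

lemma erdosRenyi_cylinderEvent (h0 : 0 ≤ p) (h1 : p ≤ 1) {A B : Finset (Sym2 (Fin n))}
    (hA : ∀ e ∈ A, ¬ e.IsDiag) (hB : ∀ e ∈ B, ¬ e.IsDiag) (hAB : Disjoint A B) :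
    (erdosRenyi n p).real (cylinderEvent A B) = p ^ A.card * (1 - p) ^ B.card := by
  have := isProbabilityMeasure_bernoulliMeasure h0 h1
  rw [erdosRenyi, map_measureReal_apply (measurable_of_finite _)
    (MeasurableSpace.measurableSet_top)]
  set w : Sym2 (Fin n) → Set Bool := fun e =>
    if e ∈ A then {true} else if e ∈ B then {false} else Set.univ with hw
  have hpre : (fun f : ({e : Sym2 (Fin n) // ¬ e.IsDiag} → Bool) =>
      SimpleGraph.fromEdgeSet {e : Sym2 (Fin n) | ∃ h : ¬ e.IsDiag, f ⟨e, h⟩ = true}) ⁻¹'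
        cylinderEvent A B = Set.univ.pi fun e => w e.1 := by
    ext f
    simp only [cylinderEvent, Set.mem_preimage, Set.mem_ofPred_eq, Set.mem_pi, Set.mem_univ,
      true_implies, SimpleGraph.edgeSet_fromEdgeSet, Set.mem_sdiff, Subtype.forall, hw]
    constructor
    · rintro ⟨ha, hb⟩ e he
      split_ifs with h h'
      · obtain ⟨⟨_, h2⟩, -⟩ := ha e h
        exact h2
      · by_contra hne
        exact hb e h' ⟨⟨he, by simpa using hne⟩, he⟩
      · trivial
    · intro h
      refine ⟨fun e he => ⟨⟨hA e he, ?_⟩, hA e he⟩, fun e he h2 => ?_⟩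
      · simpa [he] using h e (hA e he)
      · obtain ⟨⟨h3, h4⟩, -⟩ := h2
        have h5 := h e (hB e he)
        rw [if_neg (fun h6 => Finset.disjoint_left.1 hAB h6 he), if_pos he] at h5
        simp [h4] at h5
  rw [hpre, measureReal_def, Measure.pi_pi, ENNReal.toReal_prod]
  have hterm : ∀ e : {e : Sym2 (Fin n) // ¬ e.IsDiag}, (bernoulliMeasure p (w e.1)).toReal =
      (if e.1 ∈ A then p else 1) * (if e.1 ∈ B then 1 - p else 1) := by
    rintro ⟨e, he⟩
    by_cases h : e ∈ A
    · have : e ∉ B := Finset.disjoint_left.1 hAB h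
      simp [hw, h, this, bernoulliMeasure, h0]
    · by_cases h' : e ∈ B
      · simp [hw, h, h', bernoulliMeasure, h1]
      · simp only [hw, if_neg h, if_neg h', measure_univ]
        simp
  simp_rw [hterm]
  rw [Finset.prod_mul_distrib]
  have hsub : ∀ (C : Finset (Sym2 (Fin n))) (q : ℝ), (∀ e ∈ C, ¬ e.IsDiag) →
      ∏ e : {e : Sym2 (Fin n) // ¬ e.IsDiag}, (if e.1 ∈ C then q else 1) = q ^ C.card := by
    intro C q hC
    rw [← Finset.prod_subtype (Finset.univ.filter fun e : Sym2 (Fin n) => ¬ e.IsDiag) (by simp)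
      (fun e => if e ∈ C then q else 1), Finset.prod_ite, Finset.prod_const, Finset.prod_const_one,
      mul_one]
    congr 2
    ext e
    simpa using hC e
  rw [hsub A p hA, hsub B (1 - p) hB]

end Cylinder

section Rigidity

variable {n : ℕ} {G : SimpleGraph (Fin n)} {S : Finset (Fin n)}

/-- The pairs of distinct vertices of `S`. -/
def innerPairs (S : Finset (Fin n)) : Finset (Sym2 (Fin n)) :=
  S.sym2.filter fun e => ¬ e.IsDiag

lemma mem_innerPairs {e : Sym2 (Fin n)} :
    e ∈ innerPairs S ↔ (∀ v ∈ e, v ∈ S) ∧ ¬ e.IsDiag := by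
  simp [innerPairs, Finset.mem_sym2_iff]

lemma card_innerPairs (S : Finset (Fin n)) : (innerPairs S).card = S.card.choose 2 := by
  rw [← Sym2.card_image_offDiag]
  congr 1
  ext e
  induction e with
  | _ a b =>
    simp only [mem_innerPairs, Sym2.mem_iff, Finset.mem_image, Finset.mem_offDiag, Prod.exists,
      Function.uncurry_apply_pair, Sym2.mk_isDiag_iff, Sym2.eq_iff]
    constructor
    · rintro ⟨h, hab⟩
      exact ⟨a, b, ⟨h a (by simp), h b (by simp), hab⟩, by simp⟩
    · grind

lemma spannedEdges_subset_innerPairs : spannedEdges G S ⊆ innerPairs S := fun _ he =>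
  mem_innerPairs.2 ⟨he.2, G.not_isDiag_of_mem_edgeSet he.1⟩

lemma ncard_spannedEdges_le_choose : (spannedEdges G S).ncard ≤ S.card.choose 2 := by
  rw [← card_innerPairs, ← Set.ncard_coe_finset]
  exact Set.ncard_le_ncard spannedEdges_subset_innerPairs

/-- A rigid set of at least four vertices spans many edges, with minimum degree two. -/
lemma IsRigidOn.exists_subset_innerPairs (h : IsRigidOn G S) (hS : 4 ≤ S.card) :
    ∃ F ⊆ innerPairs S, (∀ e ∈ F, e ∈ G.edgeSet) ∧ F.card = 2 * S.card - 3 ∧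
      ∀ v ∈ S, 2 ≤ (F.filter fun e => v ∈ e).card := by
  classical
  obtain ⟨H, hHG, hin, hsp, hcard⟩ := h
  refine ⟨H.edgeFinset, fun e he => ?_, fun e he => ?_, ?_, fun v hv => ?_⟩
  · rw [SimpleGraph.mem_edgeFinset] at he
    exact mem_innerPairs.2 ⟨hin e he, H.not_isDiag_of_mem_edgeSet he⟩
  · exact SimpleGraph.edgeSet_mono hHG (SimpleGraph.mem_edgeFinset.1 he)
  · rw [← hcard, ← SimpleGraph.coe_edgeFinset, Set.ncard_coe_finset]
  · have h1 := hsp (S.erase v) (S.erase_subset v) (by rw [Finset.card_erase_of_mem hv]; omega)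
    rw [Finset.card_erase_of_mem hv] at h1
    have h2 := Finset.card_filter_add_card_filter_not (s := H.edgeFinset) (fun e => v ∈ e)
    have h3 : (H.edgeFinset.filter fun e => ¬ v ∈ e).card ≤ (spannedEdges H (S.erase v)).ncard := by
      rw [← Set.ncard_coe_finset]
      refine Set.ncard_le_ncard fun e he => ?_
      simp only [Finset.coe_filter, SimpleGraph.mem_edgeFinset, Set.mem_ofPred_eq] at he
      exact ⟨he.1, fun w hw => Finset.mem_erase.2 ⟨fun h => he.2 (h ▸ hw), hin e he.1 w hw⟩⟩
    rw [← SimpleGraph.coe_edgeFinset, Set.ncard_coe_finset] at hcard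
    omega

/-- Attaching a vertex by two edges preserves rigidity. -/
lemma IsRigidOn.insert (h : IsRigidOn G S) (hS : 2 ≤ S.card) {v a b : Fin n} (hv : v ∉ S)
    (ha : a ∈ S) (hb : b ∈ S) (hab : a ≠ b) (hva : G.Adj v a) (hvb : G.Adj v b) :
    IsRigidOn G (insert v S) := by
  classical
  obtain ⟨H, hHG, hin, hsp, hcard⟩ := h
  have hedge : (H ⊔ SimpleGraph.fromEdgeSet {s(v, a), s(v, b)}).edgeSet =
      H.edgeSet ∪ {s(v, a), s(v, b)} := by
    rw [SimpleGraph.edgeSet_sup, SimpleGraph.edgeSet_fromEdgeSet, sdiff_eq_left.2]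
    rw [Set.disjoint_left]
    rintro e (rfl | rfl) <;> simp [hva.ne, hvb.ne]
  have hne : s(v, a) ≠ s(v, b) := by simp [hab, hvb.ne]
  refine ⟨H ⊔ SimpleGraph.fromEdgeSet {s(v, a), s(v, b)}, ?_, ?_, ?_, ?_⟩
  · rw [← SimpleGraph.edgeSet_subset_edgeSet, hedge]
    rintro e (he | rfl | rfl)
    · exact SimpleGraph.edgeSet_mono hHG he
    · exact hva
    · exact hvb
  · rw [hedge]
    rintro e (he | rfl | rfl) w hw
    · exact Finset.mem_insert_of_mem (hin e he w hw)
    all_goals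
      rcases Sym2.mem_iff.1 hw with rfl | rfl <;> simp [*]
  · intro T hT h2
    by_cases hvT : v ∈ T
    · have hcT := Finset.card_erase_add_one hvT
      rcases Nat.lt_or_ge (T.erase v).card 2 with h3 | h3
      · refine ncard_spannedEdges_le_choose.trans ?_
        have : T.card = 2 := by omega
        simp [this]
      · have h4 := hsp (T.erase v) (by
          intro w hw
          rw [Finset.mem_erase] at hw
          exact (Finset.mem_insert.1 (hT hw.2)).resolve_left hw.1) h3
        have h5 : spannedEdges (H ⊔ SimpleGraph.fromEdgeSet {s(v, a), s(v, b)}) T ⊆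
            spannedEdges H (T.erase v) ∪ {s(v, a), s(v, b)} := by
          rintro e ⟨he, heT⟩
          rw [hedge] at he
          rcases he with he | he
          · exact Or.inl ⟨he, fun w hw => Finset.mem_erase.2
              ⟨fun h => hv (h ▸ hin e he w hw), heT w hw⟩⟩
          · exact Or.inr he
        have h6 := (Set.ncard_le_ncard h5).trans (Set.ncard_union_le _ _)
        rw [Set.ncard_pair hne] at h6
        omega
    · refine le_trans (Set.ncard_le_ncard ?_) (hsp T (fun w hw =>
        (Finset.mem_insert.1 (hT hw)).resolve_left (fun h => hvT (h ▸ hw))) h2)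
      rintro e ⟨he, heT⟩
      rw [hedge] at he
      rcases he with he | rfl | rfl
      · exact ⟨he, heT⟩
      all_goals exact absurd (heT v (by simp)) hvT
  · rw [hedge, Set.ncard_union_eq, Set.ncard_pair hne, hcard, Finset.card_insert_of_notMem hv]
    · omega
    · rw [Set.disjoint_right]
      rintro e (rfl | rfl) he <;> exact hv (hin _ he v (by simp))

lemma IsRigidComponent.card_neighbors_le_one (h : IsRigidComponent G S) {v : Fin n}
    (hv : v ∉ S) [DecidablePred (G.Adj v)] : (S.filter fun u => G.Adj v u).card ≤ 1 := by
  by_contra! hcon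
  obtain ⟨a, ha, b, hb, hab⟩ := Finset.one_lt_card.1 hcon
  rw [Finset.mem_filter] at ha hb
  have := h.2.2 _ (S.subset_insert v) (h.2.1.insert h.1 hv ha.1 hb.1 hab ha.2 hb.2)
  exact hv (this ▸ S.mem_insert_self v)

/-- A graph with more than `2n - 3` edges has a rigid component on at least four vertices. -/
lemma exists_isRigidComponent_of_lt_ncard (hn : 2 ≤ n) (hG : 2 * n - 3 < G.edgeSet.ncard) :
    ∃ S, IsRigidComponent G S ∧ 4 ≤ S.card := by
  classical
  obtain ⟨S, ⟨hS2, hSe⟩, hmin⟩ := Set.Finite.exists_minimal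
    (s := {S : Finset (Fin n) | 2 ≤ S.card ∧ 2 * S.card - 3 < (spannedEdges G S).ncard})
    (Set.toFinite _) ⟨Finset.univ, by simpa [spannedEdges] using ⟨hn, hG⟩⟩
  have hS4 : 4 ≤ S.card := by
    by_contra! hlt
    have h1 := hSe.trans_le ncard_spannedEdges_le_choose
    interval_cases S.card <;> simp [Nat.choose] at h1
  obtain ⟨F, hFS, hF⟩ := Set.exists_subset_card_eq hSe.le
  have hFG : F ⊆ G.edgeSet := fun e he => (hFS he).1
  have hedge : (SimpleGraph.fromEdgeSet F).edgeSet = F := by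
    rw [SimpleGraph.edgeSet_fromEdgeSet, sdiff_eq_left.2]
    exact Set.disjoint_left.2 fun e he => G.not_isDiag_of_mem_edgeSet (hFG he)
  have hrig : IsRigidOn G S := by
    refine ⟨SimpleGraph.fromEdgeSet F, ?_, ?_, ?_, ?_⟩
    · rwa [← SimpleGraph.edgeSet_subset_edgeSet, hedge]
    · rw [hedge]
      exact fun e he => (hFS he).2
    · intro T hT h2
      by_cases hTS : T = S
      · rw [hTS, ← hF]
        exact Set.ncard_le_ncard fun e he => hedge ▸ he.1
      · by_contra! hcon
        refine hTS (hT.antisymm (hmin ⟨h2, hcon.trans_le (Set.ncard_le_ncard ?_)⟩ hT))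
        exact fun e he => ⟨hFG (hedge ▸ he.1), he.2⟩
    · rw [hedge, hF]
  obtain ⟨M, hSM, hM, hmax⟩ := Set.Finite.exists_le_maximal
    (s := {M : Finset (Fin n) | IsRigidOn G M}) (Set.toFinite _) hrig
  have hcard := Finset.card_le_card hSM
  exact ⟨M, ⟨by omega, hM, fun S' h1 h2 => (hmax h2 h1).antisymm h1⟩, by omega⟩

end Rigidity

section Crossing

variable {n : ℕ} {p : ℝ} {S : Finset (Fin n)}

/-- The pairs joining a vertex `v` outside `S` to a vertex of `b v`. -/
def crossPairs (S : Finset (Fin n)) (b : {v // v ∉ S} → Finset (Fin n)) :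
    Finset (Sym2 (Fin n)) :=
  (Finset.univ.sigma b).image fun x => s(x.1.1, x.2)

lemma mem_crossPairs {b : {v // v ∉ S} → Finset (Fin n)} {e : Sym2 (Fin n)} :
    e ∈ crossPairs S b ↔ ∃ v, ∃ u ∈ b v, s(v.1, u) = e := by
  simp [crossPairs]

lemma cross_inj {v w : {v // v ∉ S}} {u x : Fin n} (hx : x ∈ S)
    (h : s(v.1, u) = s(w.1, x)) : v = w ∧ u = x := by
  rcases Sym2.eq_iff.1 h with ⟨h1, h2⟩ | ⟨h1, h2⟩
  · exact ⟨Subtype.ext h1, h2⟩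
  · exact absurd (h1 ▸ hx) v.2

lemma card_crossPairs {b : {v // v ∉ S} → Finset (Fin n)} (hb : ∀ v, b v ⊆ S) :
    (crossPairs S b).card = ∑ v, (b v).card := by
  rw [crossPairs, Finset.card_image_of_injOn, Finset.card_sigma]
  rintro ⟨v, u⟩ hu ⟨w, x⟩ hx h
  simp only [Finset.coe_sigma, Set.mem_sigma_iff, Finset.mem_coe] at hu hx
  obtain ⟨rfl, rfl⟩ := cross_inj (hb _ hx.2) h
  rfl

lemma disjoint_innerPairs_crossPairs {b : {v // v ∉ S} → Finset (Fin n)} :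
    Disjoint (innerPairs S) (crossPairs S b) := by
  rw [Finset.disjoint_right]
  intro e he he'
  obtain ⟨v, u, -, rfl⟩ := mem_crossPairs.1 he
  exact v.2 ((mem_innerPairs.1 he').1 v (by simp))

/-- The probability that a vertex has at most one neighbour in a given set of `k` others. -/
noncomputable def atMostOneProb (k : ℕ) (p : ℝ) : ℝ :=
  (1 - p) ^ k + k * (p * (1 - p) ^ (k - 1))

open Classical in
/-- Union bound for the event that `S` spans one of a family of configurations while every
vertex outside `S` has at most one neighbour in `S`. -/
lemma erdosRenyi_exists_cylinder_le (h0 : 0 ≤ p) (h1 : p ≤ 1)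
    (F : Finset (Finset (Sym2 (Fin n)) × Finset (Sym2 (Fin n))))
    (hF1 : ∀ q ∈ F, q.1 ⊆ innerPairs S) (hF2 : ∀ q ∈ F, q.2 ⊆ innerPairs S)
    (hF : ∀ q ∈ F, Disjoint q.1 q.2) :
    (erdosRenyi n p).real {G | (∃ q ∈ F, G ∈ cylinderEvent q.1 q.2) ∧
      ∀ v ∉ S, (S.filter fun u => G.Adj v u).card ≤ 1} ≤
      (∑ q ∈ F, p ^ q.1.card * (1 - p) ^ q.2.card) *
        atMostOneProb S.card p ^ (n - S.card) := by
  have := isProbabilityMeasure_erdosRenyi (n := n) h0 h1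
  set t : Finset (Finset (Fin n)) := insert ∅ (S.image fun u => {u}) with ht
  have htS : ∀ T ∈ t, T ⊆ S := by
    intro T hT
    rcases Finset.mem_insert.1 hT with rfl | hT
    · exact S.empty_subset
    · obtain ⟨u, hu, rfl⟩ := Finset.mem_image.1 hT
      simpa using hu
  have hsub : {G | (∃ q ∈ F, G ∈ cylinderEvent q.1 q.2) ∧
      ∀ v ∉ S, (S.filter fun u => G.Adj v u).card ≤ 1} ⊆
      ⋃ x ∈ F ×ˢ Fintype.piFinset (fun _ : {v // v ∉ S} => t),
        cylinderEvent (x.1.1 ∪ crossPairs S x.2)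
          (x.1.2 ∪ crossPairs S fun v => S \ x.2 v) := by
    rintro G ⟨⟨q, hq, hG1, hG2⟩, hG⟩
    rw [Set.mem_iUnion₂]
    refine ⟨(q, fun v => S.filter fun u => G.Adj v u), ?_, ?_, ?_⟩
    · refine Finset.mk_mem_product hq (Fintype.mem_piFinset.2 fun v => ?_)
      rcases Nat.le_one_iff_eq_zero_or_eq_one.1 (hG v.1 v.2) with h | h
      · rw [Finset.card_eq_zero.1 h]
        simp [ht]
      · obtain ⟨u, hu⟩ := Finset.card_eq_one.1 h
        have huS : u ∈ S := (Finset.mem_filter.1 (hu ▸ Finset.mem_singleton_self u)).1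
        rw [hu]
        simp [ht, huS]
    · intro e he
      rcases Finset.mem_union.1 he with he | he
      · exact hG1 e he
      · obtain ⟨v, u, hu, rfl⟩ := mem_crossPairs.1 he
        exact (Finset.mem_filter.1 hu).2
    · intro e he
      rcases Finset.mem_union.1 he with he | he
      · exact hG2 e he
      · obtain ⟨v, u, hu, rfl⟩ := mem_crossPairs.1 he
        rw [Finset.mem_sdiff, Finset.mem_filter] at hu
        exact fun h => hu.2 ⟨hu.1, h⟩
  refine (measureReal_mono hsub (measure_ne_top _ _)).trans
    ((measureReal_biUnion_finset_le _ _).trans ?_)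
  have hterm : ∀ x ∈ F ×ˢ Fintype.piFinset (fun _ : {v // v ∉ S} => t),
      (erdosRenyi n p).real (cylinderEvent (x.1.1 ∪ crossPairs S x.2)
          (x.1.2 ∪ crossPairs S fun v => S \ x.2 v)) =
        (p ^ x.1.1.card * (1 - p) ^ x.1.2.card) *
          ∏ v, p ^ (x.2 v).card * (1 - p) ^ (S.card - (x.2 v).card) := by
    rintro ⟨⟨A, B⟩, a⟩ hx
    obtain ⟨hq, ha⟩ := Finset.mem_product.1 hx
    have haS : ∀ v, a v ⊆ S := fun v => htS _ (Fintype.mem_piFinset.1 ha v)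
    have hA := hF1 _ hq
    have hB := hF2 _ hq
    have hAB := hF _ hq
    dsimp only at hA hB hAB haS ⊢
    have hdiag : ∀ b : {v // v ∉ S} → Finset (Fin n), (∀ v, b v ⊆ S) →
        ∀ e ∈ crossPairs S b, ¬ e.IsDiag := by
      intro b hb e he
      obtain ⟨v, u, hu, rfl⟩ := mem_crossPairs.1 he
      rw [Sym2.mk_isDiag_iff]
      exact fun h => v.2 (h ▸ hb v hu)
    have hd : ∀ e ∈ innerPairs S, ¬ e.IsDiag := fun e he => (mem_innerPairs.1 he).2
    rw [erdosRenyi_cylinderEvent h0 h1]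
    · rw [Finset.card_union_of_disjoint (disjoint_innerPairs_crossPairs.mono_left hA),
        Finset.card_union_of_disjoint (disjoint_innerPairs_crossPairs.mono_left hB),
        card_crossPairs haS, card_crossPairs (fun v => Finset.sdiff_subset), pow_add, pow_add,
        Finset.prod_mul_distrib, Finset.prod_pow_eq_pow_sum, Finset.prod_pow_eq_pow_sum]
      simp_rw [Finset.card_sdiff_of_subset (haS _)]
      ring
    · intro e he
      rcases Finset.mem_union.1 he with he | he
      exacts [hd e (hA he), hdiag a haS e he]
    · intro e he
      rcases Finset.mem_union.1 he with he | he
      exacts [hd e (hB he), hdiag _ (fun v => Finset.sdiff_subset) e he]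
    · refine Finset.disjoint_union_left.2 ⟨Finset.disjoint_union_right.2
        ⟨hAB, disjoint_innerPairs_crossPairs.mono_left hA⟩, Finset.disjoint_union_right.2
        ⟨(disjoint_innerPairs_crossPairs.mono_left hB).symm, ?_⟩⟩
      rw [Finset.disjoint_left]
      intro e he he'
      obtain ⟨v, u, hu, rfl⟩ := mem_crossPairs.1 he
      obtain ⟨w, x, hx, h⟩ := mem_crossPairs.1 he'
      obtain ⟨hx1, hx2⟩ := Finset.mem_sdiff.1 hx
      obtain ⟨rfl, rfl⟩ := cross_inj (haS v hu) h
      exact hx2 hu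
  rw [Finset.sum_congr rfl hterm, Finset.sum_product, Finset.sum_mul]
  refine Finset.sum_le_sum fun q _ => le_of_eq ?_
  dsimp only
  rw [← Finset.mul_sum, ← Finset.prod_univ_sum (fun _ : {v // v ∉ S} => t)
    (fun _ T => p ^ T.card * (1 - p) ^ (S.card - T.card))]
  congr 1
  rw [Finset.prod_const, ht, Finset.sum_insert (by simp), Finset.sum_image (by simp)]
  simp only [Finset.card_empty, Finset.card_singleton, Finset.sum_const, nsmul_eq_mul, pow_zero,
    pow_one, one_mul, Nat.sub_zero, atMostOneProb]
  congr 1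
  rw [Finset.card_univ, Fintype.card_subtype_compl, Fintype.card_fin]
  simp

end Crossing

section Counting

open Finset Nat

/-- The functions with domain `D` and values in `s` all of whose fibres have size at least two. -/
def denseLabelings {α V : Type*} [Fintype α] [DecidableEq α] [Fintype V] [DecidableEq V]
    (D : Finset α) (s : Finset V) : Finset (α → Option V) :=
  univ.filter fun f => (∀ x, f x = none ↔ x ∉ D) ∧ (∀ x v, f x = some v → v ∈ s) ∧
    ∀ v ∈ s, 2 ≤ (univ.filter fun x => f x = some v).card

section Labelings

variable {α V : Type*} [Fintype α] [DecidableEq α] [Fintype V] [DecidableEq V]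

lemma mem_denseLabelings {D : Finset α} {s : Finset V} {f : α → Option V} :
    f ∈ denseLabelings D s ↔ (∀ x, f x = none ↔ x ∉ D) ∧ (∀ x v, f x = some v → v ∈ s) ∧
      ∀ v ∈ s, 2 ≤ (univ.filter fun x => f x = some v).card := by
  simp [denseLabelings]

lemma card_denseLabelings_insert_le {D : Finset α} {s : Finset V} {a : V} (ha : a ∉ s) :
    (denseLabelings D (insert a s)).card ≤
      ∑ T ∈ D.powerset.filter (fun T => 2 ≤ T.card), (denseLabelings (D \ T) s).card := by
  rw [← card_sigma]
  refine card_le_card_of_injOn (fun f => ⟨univ.filter fun x => f x = some a,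
    fun x => if f x = some a then none else f x⟩) ?_ ?_
  · intro f hf
    obtain ⟨h1, h2, h3⟩ := mem_denseLabelings.1 hf
    simp only [coe_sigma, Set.mem_sigma_iff, mem_coe, mem_filter, mem_powerset]
    refine ⟨⟨fun x hx => ?_, h3 a (mem_insert_self a s)⟩, mem_denseLabelings.2 ⟨fun x => ?_,
      fun x v hx => ?_, fun v hv => ?_⟩⟩
    · by_contra hxD
      simp [(h1 x).2 hxD] at hx
    · by_cases hx : f x = some a
      · simp [hx]
      · simp [hx, h1 x]
    · split_ifs at hx with h
      refine (mem_insert.1 (h2 x v hx)).resolve_left ?_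
      rintro rfl
      exact h hx
    · refine (h3 v (mem_insert_of_mem hv)).trans (card_le_card fun x hx => ?_)
      have hne : v ≠ a := fun h => ha (h ▸ hv)
      simp only [mem_filter, mem_univ, true_and] at hx ⊢
      simp [hx, hne]
  · intro f _ g _ h
    simp only [Sigma.mk.injEq, heq_eq_eq, Finset.ext_iff, mem_filter, mem_univ, true_and] at h
    funext x
    have h1 := h.1 x
    have h2 := congrFun h.2 x
    by_cases hx : f x = some a
    · rw [hx, h1.1 hx]
    · simpa [hx, mt h1.2 hx] using h2

lemma card_denseLabelings_mul_pow_le {t : ℝ} (ht : 0 ≤ t) (s : Finset V) (D : Finset α) :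
    ((denseLabelings D s).card : ℝ) * t ^ D.card ≤
      D.card ! * (Real.exp t - 1 - t) ^ s.card := by
  have hg : 0 ≤ Real.exp t - 1 - t := by linarith [Real.add_one_le_exp t]
  induction s using Finset.induction_on generalizing D with
  | empty =>
    rcases D.eq_empty_or_nonempty with rfl | ⟨x, hx⟩
    · have : denseLabelings (∅ : Finset α) (∅ : Finset V) ⊆ {fun _ => none} := by
        intro f hf
        rw [mem_singleton]
        funext x
        exact ((mem_denseLabelings.1 hf).1 x).2 (by simp)
      simpa using card_le_card this
    · have : denseLabelings D (∅ : Finset V) = ∅ := by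
        rw [eq_empty_iff_forall_notMem]
        intro f hf
        obtain ⟨h1, h2, -⟩ := mem_denseLabelings.1 hf
        cases hfx : f x with
        | none => exact (h1 x).1 hfx hx
        | some v => simpa using h2 x v hfx
      rw [this]
      simp
  | insert a s ha ih =>
    have hstep : ∀ T ∈ D.powerset.filter (fun T => 2 ≤ T.card),
        ((denseLabelings (D \ T) s).card : ℝ) * t ^ D.card ≤
          (D.card - T.card)! * (Real.exp t - 1 - t) ^ s.card * t ^ T.card := by
      intro T hT
      have hTD := mem_powerset.1 (mem_filter.1 hT).1
      have h1 := ih (D \ T)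
      rw [card_sdiff_of_subset hTD] at h1
      have h2 : D.card = D.card - T.card + T.card := (Nat.sub_add_cancel (card_le_card hTD)).symm
      calc ((denseLabelings (D \ T) s).card : ℝ) * t ^ D.card
          = (denseLabelings (D \ T) s).card * t ^ (D.card - T.card) * t ^ T.card := by
            rw [mul_assoc, ← pow_add, ← h2]
        _ ≤ _ := by gcongr
    have hsum : ∑ T ∈ D.powerset.filter (fun T => 2 ≤ T.card),
        ((D.card - T.card)! : ℝ) * (Real.exp t - 1 - t) ^ s.card * t ^ T.card =
        D.card ! * (Real.exp t - 1 - t) ^ s.card *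
          ∑ i ∈ (range (D.card + 1)).filter (2 ≤ ·), t ^ i / i ! := by
      rw [sum_filter, sum_powerset_apply_card
        (fun i => if 2 ≤ i then ((D.card - i)! : ℝ) * (Real.exp t - 1 - t) ^ s.card * t ^ i else 0),
        mul_sum, sum_filter]
      refine sum_congr rfl fun i hi => ?_
      split_ifs
      · rw [nsmul_eq_mul, Nat.cast_choose ℝ (by simpa [Nat.lt_succ_iff] using hi)]
        have := Nat.factorial_ne_zero (D.card - i)
        have := Nat.factorial_ne_zero i
        field_simp
      · simp
    have hexp : ∑ i ∈ (range (D.card + 1)).filter (2 ≤ ·), t ^ i / i ! ≤ Real.exp t - 1 - t := by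
      have h2 : ∑ i ∈ (range (D.card + 1)).filter (2 ≤ ·), t ^ i / i ! ≤
          ∑ i ∈ (range (D.card + 2)).filter (2 ≤ ·), t ^ i / i ! := by
        refine sum_le_sum_of_subset_of_nonneg (filter_subset_filter _ (by simp)) ?_
        intros
        positivity
      have h3 := sum_filter_add_sum_filter_not (range (D.card + 2)) (2 ≤ ·)
        (fun i => t ^ i / (i ! : ℝ))
      have h4 : (range (D.card + 2)).filter (fun i => ¬ 2 ≤ i) = range 2 := by
        ext i
        simp
        omega
      rw [h4, sum_range_succ, sum_range_one] at h3
      have h1 := Real.sum_le_exp_of_nonneg ht (D.card + 2)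
      simp only [pow_zero, pow_one, Nat.factorial, Nat.cast_one] at h3
      linarith
    calc ((denseLabelings D (insert a s)).card : ℝ) * t ^ D.card
        ≤ (∑ T ∈ D.powerset.filter (fun T => 2 ≤ T.card),
            ((denseLabelings (D \ T) s).card : ℝ)) * t ^ D.card := by
          have := card_denseLabelings_insert_le (D := D) ha
          gcongr
          exact_mod_cast this
      _ ≤ D.card ! * (Real.exp t - 1 - t) ^ s.card *
          ∑ i ∈ (range (D.card + 1)).filter (2 ≤ ·), t ^ i / i ! := by
          rw [sum_mul, ← hsum]
          exact sum_le_sum hstep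
      _ ≤ _ := by
          rw [card_insert_of_notMem ha, pow_succ, ← mul_assoc]
          gcongr

end Labelings

variable {n : ℕ}

/-- The graphs on `S` with `j` edges and minimum degree at least two, as sets of pairs. -/
def minDegTwo (S : Finset (Fin n)) (j : ℕ) : Finset (Finset (Sym2 (Fin n))) :=
  ((innerPairs S).powersetCard j).filter fun F => ∀ v ∈ S, 2 ≤ (F.filter fun e => v ∈ e).card

lemma card_minDegTwo_mul_le (S : Finset (Fin n)) (j : ℕ) :
    (minDegTwo S j).card * (j ! * 2 ^ j) ≤
      (denseLabelings (univ : Finset (Fin j × Bool)) S).card := by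
  have hrep : ∀ e : Sym2 (Fin n), ∃ a b, s(a, b) = e := fun e => by
    induction e with
    | _ a b => exact ⟨a, b, rfl⟩
  choose x y hxy using hrep
  have hF : ∀ F : minDegTwo S j, F.1.card = j := fun F =>
    (mem_powersetCard.1 (mem_filter.1 F.2).1).2
  have hFS : ∀ F : minDegTwo S j, F.1 ⊆ innerPairs S := fun F =>
    (mem_powersetCard.1 (mem_filter.1 F.2).1).1
  let lab : (Σ F : minDegTwo S j, (Fin j ≃ F.1) × (Fin j → Bool)) → Fin j × Bool →
      Option (Fin n) := fun q i =>
    some (if q.2.2 i.1 = i.2 then x (q.2.1 i.1).1 else y (q.2.1 i.1).1)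
  have hmem : ∀ q, lab q ∈ denseLabelings univ S := by
    rintro ⟨F, σ, b⟩
    refine mem_denseLabelings.2 ⟨by simp [lab], ?_, fun v hv => ?_⟩
    · rintro i v hv
      simp only [lab, Option.some.injEq] at hv
      have h1 := (mem_innerPairs.1 (hFS F (σ i.1).2)).1 v
      rw [← hxy (σ i.1).1] at h1
      refine h1 (Sym2.mem_iff.2 ?_)
      split_ifs at hv
      exacts [Or.inl hv.symm, Or.inr hv.symm]
    · refine ((mem_filter.1 F.2).2 v hv).trans (card_le_card_of_surjOn (fun i => (σ i.1).1) ?_)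
      intro e he
      simp only [coe_filter, Set.mem_ofPred_eq] at he
      have h2 := he.2
      rw [← hxy e, Sym2.mem_iff] at h2
      rcases h2 with h2 | h2
      · exact ⟨(σ.symm ⟨e, he.1⟩, b (σ.symm ⟨e, he.1⟩)), by simp [lab, h2], by simp⟩
      · exact ⟨(σ.symm ⟨e, he.1⟩, ! b (σ.symm ⟨e, he.1⟩)), by simp [lab, h2], by simp⟩
  have hpair : ∀ q i, ∃ a c, lab q (i, true) = some a ∧ lab q (i, false) = some c ∧
      s(a, c) = (q.2.1 i).1 := by
    rintro ⟨F, σ, b⟩ i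
    cases hb : b i
    · exact ⟨y (σ i).1, x (σ i).1, by simp [lab, hb], by simp [lab, hb],
        by rw [Sym2.eq_swap, hxy]⟩
    · exact ⟨x (σ i).1, y (σ i).1, by simp [lab, hb], by simp [lab, hb], hxy _⟩
  have hinj : Function.Injective lab := by
    rintro ⟨F, σ, b⟩ ⟨F', σ', b'⟩ h
    have hσ : ∀ i, (σ i).1 = (σ' i).1 := by
      intro i
      obtain ⟨a, c, h1, h2, h3⟩ := hpair ⟨F, σ, b⟩ i
      obtain ⟨a', c', h1', h2', h3'⟩ := hpair ⟨F', σ', b'⟩ i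
      rw [h, h1', Option.some.injEq] at h1
      rw [h, h2', Option.some.injEq] at h2
      rw [← h3, ← h3', h1, h2]
    have hFF : F = F' := by
      refine Subtype.ext (eq_of_subset_of_card_le (fun e he => ?_) (by rw [hF, hF]))
      have := hσ (σ.symm ⟨e, he⟩)
      rw [Equiv.apply_symm_apply] at this
      exact (show e = _ from this) ▸ (σ' _).2
    subst hFF
    have hσσ : σ = σ' := Equiv.ext fun i => Subtype.ext (hσ i)
    subst hσσ
    have hbb : b = b' := by
      funext i
      by_contra hne
      have h1 := congrFun h (i, b i)
      simp only [lab, Option.some.injEq, if_true, if_neg (Ne.symm hne)] at h1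
      refine (mem_innerPairs.1 (hFS F (σ i).2)).2 ?_
      rw [← hxy (σ i).1, Sym2.mk_isDiag_iff]
      exact h1
    rw [hbb]
  have hcard : Fintype.card (Σ F : minDegTwo S j, (Fin j ≃ F.1) × (Fin j → Bool)) =
      (minDegTwo S j).card * (j ! * 2 ^ j) := by
    rw [Fintype.card_sigma]
    have : ∀ F : minDegTwo S j, Fintype.card ((Fin j ≃ F.1) × (Fin j → Bool)) = j ! * 2 ^ j := by
      intro F
      rw [Fintype.card_prod, Fintype.card_equiv (F.1.equivFinOfCardEq (hF F)).symm]
      simp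
    simp [this]
  rw [← hcard, ← Finset.card_univ]
  exact card_le_card_of_injOn lab (fun q _ => hmem q) hinj.injOn

lemma card_minDegTwo_le (S : Finset (Fin n)) (j : ℕ) {t : ℝ} (ht : 0 < t) :
    ((minDegTwo S j).card : ℝ) ≤
      (2 * j)! / (j ! * 2 ^ j * t ^ (2 * j)) * (Real.exp t - 1 - t) ^ S.card := by
  have h1 := card_denseLabelings_mul_pow_le ht.le S (univ : Finset (Fin j × Bool))
  have h2 : (univ : Finset (Fin j × Bool)).card = 2 * j := by simp [mul_comm]
  have h3 : ((minDegTwo S j).card : ℝ) * (j ! * 2 ^ j) ≤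
      (denseLabelings (univ : Finset (Fin j × Bool)) S).card := by
    exact_mod_cast card_minDegTwo_mul_le S j
  rw [h2] at h1
  rw [div_mul_eq_mul_div, le_div_iff₀ (by positivity), ← mul_assoc]
  refine le_trans ?_ h1
  gcongr

end Counting

section UnionBounds

variable {n : ℕ} {p : ℝ} {S : Finset (Fin n)}

lemma erdosRenyi_ncard_edgeSet_le (h0 : 0 ≤ p) (h1 : p ≤ 1) (M : ℕ) {z : ℝ} (hz : 0 < z)
    (hz1 : z ≤ 1) :
    (erdosRenyi n p).real {G | G.edgeSet.ncard ≤ M} ≤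
      (z⁻¹) ^ M * (z * p + (1 - p)) ^ n.choose 2 := by
  classical
  have := isProbabilityMeasure_erdosRenyi (n := n) h0 h1
  set U : Finset (Sym2 (Fin n)) := innerPairs Finset.univ with hU
  have hUcard : U.card = n.choose 2 := by rw [hU, card_innerPairs, Finset.card_fin]
  have hsub : {G : SimpleGraph (Fin n) | G.edgeSet.ncard ≤ M} ⊆
      ⋃ A ∈ U.powerset.filter (fun A => A.card ≤ M), cylinderEvent A (U \ A) := by
    intro G hG
    rw [Set.mem_iUnion₂]
    refine ⟨G.edgeFinset, ?_, fun e he => SimpleGraph.mem_edgeFinset.1 he, fun e he h => ?_⟩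
    · rw [Finset.mem_filter, Finset.mem_powerset]
      refine ⟨fun e he => mem_innerPairs.2 ⟨by simp, ?_⟩, ?_⟩
      · exact G.not_isDiag_of_mem_edgeSet (SimpleGraph.mem_edgeFinset.1 he)
      · rwa [← Set.ncard_coe_finset, SimpleGraph.coe_edgeFinset]
    · exact (Finset.mem_sdiff.1 he).2 (SimpleGraph.mem_edgeFinset.2 h)
  refine (measureReal_mono hsub (measure_ne_top _ _)).trans
    ((measureReal_biUnion_finset_le _ _).trans ?_)
  rw [← hUcard, ← Finset.sum_pow_mul_eq_add_pow, Finset.mul_sum]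
  have hq : 0 ≤ 1 - p := sub_nonneg.2 h1
  refine (Finset.sum_le_sum fun A hA => ?_).trans
    (Finset.sum_le_sum_of_subset_of_nonneg (Finset.filter_subset _ _) fun _ _ _ => by positivity)
  rw [Finset.mem_filter, Finset.mem_powerset] at hA
  rw [erdosRenyi_cylinderEvent h0 h1 (fun e he => (mem_innerPairs.1 (hA.1 he)).2)
    (fun e he => (mem_innerPairs.1 (Finset.mem_sdiff.1 he).1).2) Finset.disjoint_sdiff,
    Finset.card_sdiff_of_subset hA.1, mul_pow]
  have hone : 1 ≤ (z⁻¹) ^ M * z ^ A.card := by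
    rw [← Nat.sub_add_cancel hA.2, pow_add, mul_assoc, ← mul_pow, inv_mul_cancel₀ hz.ne', one_pow,
      mul_one]
    exact one_le_pow₀ ((one_le_inv₀ hz).2 hz1)
  calc p ^ A.card * (1 - p) ^ (U.card - A.card)
      ≤ (z⁻¹ ^ M * z ^ A.card) * (p ^ A.card * (1 - p) ^ (U.card - A.card)) :=
        le_mul_of_one_le_left (by positivity) hone
    _ = _ := by ring

lemma erdosRenyi_isRigidOn_le (h0 : 0 ≤ p) (h1 : p ≤ 1) (hS : 4 ≤ S.card) :
    (erdosRenyi n p).real {G | IsRigidOn G S} ≤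
      (S.card.choose 2).choose (2 * S.card - 3) * p ^ (2 * S.card - 3) := by
  have := isProbabilityMeasure_erdosRenyi (n := n) h0 h1
  have hsub : {G | IsRigidOn G S} ⊆
      ⋃ A ∈ (innerPairs S).powersetCard (2 * S.card - 3), cylinderEvent A ∅ := by
    intro G hG
    obtain ⟨F, hFS, hFG, hF, -⟩ := IsRigidOn.exists_subset_innerPairs hG hS
    rw [Set.mem_iUnion₂]
    exact ⟨F, Finset.mem_powersetCard.2 ⟨hFS, hF⟩, hFG, by simp⟩
  refine (measureReal_mono hsub (measure_ne_top _ _)).trans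
    ((measureReal_biUnion_finset_le _ _).trans (le_of_eq ?_))
  rw [Finset.sum_congr rfl (g := fun _ => p ^ (2 * S.card - 3)), Finset.sum_const,
    Finset.card_powersetCard, card_innerPairs, nsmul_eq_mul]
  intro A hA
  obtain ⟨hAS, hA⟩ := Finset.mem_powersetCard.1 hA
  rw [erdosRenyi_cylinderEvent h0 h1 (fun e he => (mem_innerPairs.1 (hAS he)).2) (by simp)
    (by simp), hA]
  simp

lemma erdosRenyi_isRigidComponent_le_atMostOneProb (h0 : 0 ≤ p) (h1 : p ≤ 1) :
    (erdosRenyi n p).real {G | IsRigidComponent G S} ≤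
      atMostOneProb S.card p ^ (n - S.card) := by
  classical
  have := isProbabilityMeasure_erdosRenyi (n := n) h0 h1
  have h := erdosRenyi_exists_cylinder_le (n := n) (S := S) h0 h1 {(∅, ∅)} (by simp) (by simp)
    (by simp)
  rw [Finset.sum_singleton, Finset.card_empty, pow_zero, pow_zero, one_mul, one_mul] at h
  refine (measureReal_mono ?_ (measure_ne_top _ _)).trans h
  intro G hG
  refine ⟨by simp [cylinderEvent], fun v hv => ?_⟩
  convert hG.card_neighbors_le_one hv

lemma erdosRenyi_isRigidComponent_le (h0 : 0 ≤ p) (h1 : p ≤ 1) (hS : 4 ≤ S.card) :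
    (erdosRenyi n p).real {G | IsRigidComponent G S} ≤
      (∑ j ∈ Finset.Ico (2 * S.card - 3) (3 * S.card),
          (minDegTwo S j).card * (p ^ j * (1 - p) ^ (S.card.choose 2 - j)) +
        (S.card.choose 2).choose (3 * S.card) * p ^ (3 * S.card)) *
        atMostOneProb S.card p ^ (n - S.card) := by
  classical
  have := isProbabilityMeasure_erdosRenyi (n := n) h0 h1
  let ev : Finset (Finset (Sym2 (Fin n)) × Finset (Sym2 (Fin n))) → Set (SimpleGraph (Fin n)) :=
    fun F => {G | (∃ q ∈ F, G ∈ cylinderEvent q.1 q.2) ∧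
      ∀ v ∉ S, (S.filter fun u => G.Adj v u).card ≤ 1}
  let F₁ : ℕ → Finset (Finset (Sym2 (Fin n)) × Finset (Sym2 (Fin n))) := fun j =>
    (minDegTwo S j).image fun A => (A, innerPairs S \ A)
  let F₂ : Finset (Finset (Sym2 (Fin n)) × Finset (Sym2 (Fin n))) :=
    ((innerPairs S).powersetCard (3 * S.card)).image fun A => (A, ∅)
  have hsub : {G | IsRigidComponent G S} ⊆
      (⋃ j ∈ Finset.Ico (2 * S.card - 3) (3 * S.card), ev (F₁ j)) ∪ ev F₂ := by
    intro G hG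
    have hout : ∀ v ∉ S, (S.filter fun u => G.Adj v u).card ≤ 1 := fun v hv => by
      convert hG.card_neighbors_le_one hv
    obtain ⟨F, hFS, hFG, hF, hdeg⟩ := hG.2.1.exists_subset_innerPairs hS
    set E := (innerPairs S).filter (· ∈ G.edgeSet) with hE
    have hFE : F ⊆ E := fun e he => Finset.mem_filter.2 ⟨hFS he, hFG e he⟩
    rcases Nat.lt_or_ge E.card (3 * S.card) with hlt | hge
    · refine Or.inl (Set.mem_iUnion₂.2 ⟨E.card, Finset.mem_Ico.2
        ⟨hF ▸ Finset.card_le_card hFE, hlt⟩, ⟨(E, innerPairs S \ E), ?_, ?_, ?_⟩, hout⟩)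
      · refine Finset.mem_image_of_mem _ (Finset.mem_filter.2 ⟨Finset.mem_powersetCard.2
          ⟨Finset.filter_subset _ _, rfl⟩, fun v hv => (hdeg v hv).trans
          (Finset.card_le_card (Finset.filter_subset_filter _ hFE))⟩)
      · exact fun e he => (Finset.mem_filter.1 he).2
      · intro e he h
        obtain ⟨h2, h3⟩ := Finset.mem_sdiff.1 he
        exact h3 (Finset.mem_filter.2 ⟨h2, h⟩)
    · obtain ⟨A, hAE, hA⟩ := Finset.exists_subset_card_eq hge
      refine Or.inr ⟨⟨(A, ∅), Finset.mem_image_of_mem _ (Finset.mem_powersetCard.2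
        ⟨hAE.trans (Finset.filter_subset _ _), hA⟩), fun e he =>
          (Finset.mem_filter.1 (hAE he)).2, by simp⟩, hout⟩
  have hev₁ : ∀ j, (erdosRenyi n p).real (ev (F₁ j)) ≤
      (minDegTwo S j).card * (p ^ j * (1 - p) ^ (S.card.choose 2 - j)) *
        atMostOneProb S.card p ^ (n - S.card) := by
    intro j
    have hmem : ∀ q ∈ F₁ j, q.1 ⊆ innerPairs S ∧ q.2 = innerPairs S \ q.1 := by
      intro q hq
      obtain ⟨A, hA, rfl⟩ := Finset.mem_image.1 hq
      exact ⟨(Finset.mem_powersetCard.1 (Finset.mem_filter.1 hA).1).1, rfl⟩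
    refine (erdosRenyi_exists_cylinder_le h0 h1 (F₁ j) (fun q hq => (hmem q hq).1)
      (fun q hq => (hmem q hq).2 ▸ Finset.sdiff_subset)
      (fun q hq => (hmem q hq).2 ▸ Finset.disjoint_sdiff)).trans (le_of_eq ?_)
    congr 1
    rw [Finset.sum_image (fun A _ B _ h => (Prod.ext_iff.1 h).1), ← nsmul_eq_mul,
      ← Finset.sum_const]
    refine Finset.sum_congr rfl fun A hA => ?_
    obtain ⟨hAS, hA⟩ := Finset.mem_powersetCard.1 (Finset.mem_filter.1 hA).1
    rw [Finset.card_sdiff_of_subset hAS, hA, card_innerPairs]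
  have hev₂ : (erdosRenyi n p).real (ev F₂) ≤
      (S.card.choose 2).choose (3 * S.card) * p ^ (3 * S.card) *
        atMostOneProb S.card p ^ (n - S.card) := by
    have hmem : ∀ q ∈ F₂, q.1 ⊆ innerPairs S ∧ q.2 = ∅ := by
      intro q hq
      obtain ⟨A, hA, rfl⟩ := Finset.mem_image.1 hq
      exact ⟨(Finset.mem_powersetCard.1 hA).1, rfl⟩
    refine (erdosRenyi_exists_cylinder_le h0 h1 F₂ (fun q hq => (hmem q hq).1)
      (fun q hq => by simp [(hmem q hq).2]) (fun q hq => by simp [(hmem q hq).2])).trans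
      (le_of_eq ?_)
    congr 1
    rw [Finset.sum_image (fun A _ B _ h => (Prod.ext_iff.1 h).1), ← card_innerPairs,
      ← Finset.card_powersetCard, ← nsmul_eq_mul, ← Finset.sum_const]
    refine Finset.sum_congr rfl fun A hA => ?_
    rw [(Finset.mem_powersetCard.1 hA).2]
    simp
  refine (measureReal_mono hsub (measure_ne_top _ _)).trans
    ((measureReal_union_le _ _).trans ?_)
  rw [add_mul, Finset.sum_mul]
  exact add_le_add ((measureReal_biUnion_finset_le _ _).trans
    (Finset.sum_le_sum fun j _ => hev₁ j)) hev₂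

end UnionBounds

section Exponents

open Real

lemma log_one_add_le_quintic {y : ℝ} (hy : 0 ≤ y) :
    log (1 + y) ≤ y - y ^ 2 / 2 + y ^ 3 / 3 - y ^ 4 / 4 + y ^ 5 / 5 := by
  have hd : ∀ x : ℝ, 0 ≤ x → HasDerivAt
      (fun x => x - x ^ 2 / 2 + x ^ 3 / 3 - x ^ 4 / 4 + x ^ 5 / 5 - log (1 + x))
      (x ^ 5 / (1 + x)) x := by
    intro x hx
    have hx' : 1 + x ≠ 0 := by positivity
    have h1 := ((hasDerivAt_id' x).const_add 1).log hx'
    have h2 := (((((hasDerivAt_id' x).sub ((hasDerivAt_pow 2 x).div_const 2)).add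
      ((hasDerivAt_pow 3 x).div_const 3)).sub ((hasDerivAt_pow 4 x).div_const 4)).add
      ((hasDerivAt_pow 5 x).div_const 5)).sub h1
    refine h2.congr_deriv ?_
    field_simp
    norm_num
    ring
  have hmono : MonotoneOn
      (fun x : ℝ => x - x ^ 2 / 2 + x ^ 3 / 3 - x ^ 4 / 4 + x ^ 5 / 5 - log (1 + x))
      (Set.Ici 0) := by
    refine monotoneOn_of_deriv_nonneg (convex_Ici 0)
      (fun x hx => (hd x hx).continuousAt.continuousWithinAt)
      (fun x hx => (hd x (interior_subset hx)).differentiableAt.differentiableWithinAt)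
      fun x hx => ?_
    have hx0 : 0 ≤ x := interior_subset hx
    rw [(hd x hx0).deriv]
    positivity
  have h := hmono Set.self_mem_Ici hy hy
  simp at h
  linarith

lemma log_le_log_add_mul_sub_one {a b x : ℝ} (ha : 0 < a) (hab : a * b = 1) (hx : 0 < x) :
    log x ≤ log a + b * x - 1 := by
  have hb : 0 < b := pos_of_mul_pos_right (hab ▸ one_pos) ha.le
  have h := log_le_sub_one_of_pos (mul_pos hb hx)
  have h' : log a + log b = 0 := by
    rw [← log_mul ha.ne' hb.ne', hab, log_one]
  rw [log_mul hb.ne' hx.ne'] at h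
  linarith

lemma log_exp_four_sub_five_le : log (exp 4 - 5) ≤ 3.905 := by
  have h4 : exp 4 = exp 1 ^ 4 := by rw [← exp_nat_mul]; norm_num
  have h1 : exp 1 ^ 4 < 2.7182818286 ^ 4 := by gcongr; exact exp_one_lt_d9
  have h2 : (2.7182818283 : ℝ) ^ 4 < exp 1 ^ 4 := by gcongr; exact exp_one_gt_d9
  rw [log_le_iff_le_exp (by rw [h4]; norm_num at h2 ⊢; linarith)]
  have h3 : exp 3.905 = exp 4 * exp (-0.011875) ^ 8 := by
    rw [← exp_nat_mul, ← exp_add]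
    norm_num
  have h5 : (1 - 0.011875 : ℝ) ^ 8 ≤ exp (-0.011875) ^ 8 := by
    gcongr
    linarith [add_one_le_exp (-0.011875 : ℝ)]
  rw [h3, h4]
  nlinarith [exp_pos 1]

lemma component_exponent_le {r y : ℝ} (hr : 10 ≤ r) (hy : 0 < y) :
    log (exp 4 - 5) - 1 + log r + 2 * log (y / 4) - y / 2 + (r - 1) * (log (1 + y) - y) ≤
      -(1 / 200) := by
  have hs := log_exp_four_sub_five_le
  have hr0 : 0 < r := by linarith
  have hlog4 : log (y / 4) = log y - 2 * log 2 := by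
    rw [log_div hy.ne' (by norm_num), show (4 : ℝ) = 2 ^ 2 by norm_num, log_pow]
    norm_num
  have hl2 := log_two_gt_d9
  rcases le_or_gt y 0.53 with hy1 | hy1
  · have hq := log_one_add_le_quintic hy.le
    set q : ℝ := 1 / 2 - y / 3 + y ^ 2 / 4 - y ^ 3 / 5 with hqdef
    have hq0 : 0 < q := by
      rw [hqdef]
      nlinarith [sq_nonneg y, pow_pos hy 3, pow_le_pow_left₀ hy.le hy1 3]
    have hφ : y ^ 2 * q ≤ y - log (1 + y) := by rw [hqdef]; linarith
    have hφ0 : 0 < y - log (1 + y) := lt_of_lt_of_le (by positivity) hφ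
    have h1 := log_le_sub_one_of_pos (mul_pos hr0 hφ0)
    rw [log_mul hr0.ne' hφ0.ne'] at h1
    have h2 := log_le_log (by positivity) hφ
    rw [log_mul (by positivity) hq0.ne', log_pow] at h2
    have h3 : exp (y / 2) ≤ 1 + y / 2 + y ^ 2 / 8 + y ^ 3 / 36 := by
      have := exp_bound' (x := y / 2) (by linarith) (by linarith) (n := 3) (by norm_num)
      norm_num [Finset.sum_range_succ, Nat.factorial] at this
      linarith
    have h4 : 0.4225 * exp (y / 2) ≤ q * (1 + y) := by
      refine (mul_le_mul_of_nonneg_left h3 (by norm_num)).trans ?_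
      rw [hqdef]
      nlinarith [mul_nonneg hy.le (sub_nonneg.2 hy1), pow_pos hy 3, pow_pos hy 2,
        mul_nonneg (pow_pos hy 2).le (sub_nonneg.2 hy1),
        mul_nonneg (pow_pos hy 3).le (sub_nonneg.2 hy1)]
    have h5 := log_le_log (by positivity) h4
    rw [log_mul (by norm_num) (exp_pos _).ne', log_exp, log_mul hq0.ne' (by positivity)] at h5
    have h6 : -0.8625 ≤ log 0.4225 := by
      rw [le_log_iff_exp_le (by norm_num), exp_neg]
      refine inv_le_of_inv_le₀ (by norm_num) ?_
      have := sum_le_exp_of_nonneg (x := 0.8625) (by norm_num) 6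
      refine le_trans ?_ this
      norm_num [Finset.sum_range_succ, Nat.factorial]
    rw [hlog4]
    push_cast at h2
    nlinarith
  · have h1 := log_le_log_add_mul_sub_one (a := 10) (b := 1 / 10) (by norm_num) (by norm_num) hr0
    have h2 := log_le_log_add_mul_sub_one (a := 0.55) (b := 20 / 11) (by norm_num) (by norm_num) hy
    have h3 := log_le_log_add_mul_sub_one (a := 1.55) (b := 20 / 31) (x := 1 + y)
      (by norm_num) (by norm_num) (by linarith)
    have h4 := log_le_log_add_mul_sub_one (a := 1.53) (b := 100 / 153) (x := 1 + y)
      (by norm_num) (by norm_num) (by linarith)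
    have h5 : log 1.53 ≤ 0.43 := by
      rw [log_le_iff_le_exp (by norm_num)]
      refine le_trans ?_ (sum_le_exp_of_nonneg (x := 0.43) (by norm_num) 5)
      norm_num [Finset.sum_range_succ, Nat.factorial]
    have h6 : 0.1 ≤ y - log (1 + y) := by linarith
    have h7 : log 10 - 4 * log 2 + 2 * log 0.55 + 9 * log 1.55 ≤ 2.29 := by
      have : log (10 / 2 ^ 4 * 0.55 ^ 2 * 1.55 ^ 9) ≤ 2.29 := by
        rw [log_le_iff_le_exp (by norm_num)]
        refine le_trans ?_ (sum_le_exp_of_nonneg (x := 2.29) (by norm_num) 10)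
        norm_num [Finset.sum_range_succ, Nat.factorial]
      rw [log_mul (by norm_num) (by norm_num), log_mul (by norm_num) (by norm_num),
        log_div (by norm_num) (by norm_num), log_pow, log_pow, log_pow] at this
      push_cast at this
      linarith
    rw [hlog4]
    have h8 : (r - 10) * (0.1 - (y - log (1 + y))) ≤ 0 :=
      mul_nonpos_of_nonneg_of_nonpos (by linarith) (by linarith)
    nlinarith

lemma neighbour_exponent_le {r y : ℝ} (hr : 10 ≤ r) (hy : 3 / 2 ≤ y) :
    1 + log r + (r - 1) * (log (1 + y) - y) ≤ -(1 / 200) := by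
  have h1 := log_le_log_add_mul_sub_one (a := 10) (b := 1 / 10) (x := r)
    (by norm_num) (by norm_num) (by linarith)
  have h2 := log_le_log_add_mul_sub_one (a := 2.5) (b := 2 / 5) (x := 1 + y)
      (by norm_num) (by norm_num) (by linarith)
  have h3 : log 2.5 ≤ 0.92 := by
    rw [log_le_iff_le_exp (by norm_num)]
    refine le_trans ?_ (sum_le_exp_of_nonneg (x := 0.92) (by norm_num) 8)
    norm_num [Finset.sum_range_succ, Nat.factorial]
  have h4 : log 10 ≤ 2.4 := by
    rw [log_le_iff_le_exp (by norm_num)]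
    refine le_trans ?_ (sum_le_exp_of_nonneg (x := 2.4) (by norm_num) 10)
    norm_num [Finset.sum_range_succ, Nat.factorial]
  have h5 : log (1 + y) - y ≤ -0.58 := by linarith
  nlinarith

end Exponents

section Asymptotics

open Real
open scoped Nat

lemma choose_le_div_pow_mul_exp {N k : ℕ} (hk : 0 < k) :
    (N.choose k : ℝ) ≤ ((N : ℝ) / k * exp 1) ^ k := by
  have hk' : (0 : ℝ) < k := by exact_mod_cast hk
  have h1 : (N.choose k : ℝ) ≤ (N : ℝ) ^ k / (k ! : ℕ) := Nat.choose_le_pow_div k N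
  have h2 := pow_div_factorial_le_exp (k : ℝ) hk'.le k
  have h3 : exp (k : ℝ) = exp 1 ^ k := by rw [← exp_nat_mul, mul_one]
  calc (N.choose k : ℝ) ≤ (N : ℝ) ^ k / (k ! : ℕ) := h1
    _ = ((N : ℝ) / k) ^ k * ((k : ℝ) ^ k / (k ! : ℕ)) := by
        rw [div_pow]; field_simp
    _ ≤ ((N : ℝ) / k) ^ k * exp k := by gcongr
    _ = _ := by rw [h3, mul_pow]

lemma choose_le_exp {N k : ℕ} (hk : 0 < k) (hN : 0 < N) :
    (N.choose k : ℝ) ≤ exp (k * (1 + log ((N : ℝ) / k))) := by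
  refine (choose_le_div_pow_mul_exp hk).trans (le_of_eq ?_)
  rw [exp_nat_mul, exp_add, exp_log (by positivity), mul_comm]

lemma one_sub_pow_le_exp {p : ℝ} (h1 : p ≤ 1) (m : ℕ) : (1 - p) ^ m ≤ exp (-(m * p)) := by
  calc (1 - p) ^ m ≤ exp (-p) ^ m := by
        gcongr
        linarith [add_one_le_exp (-p)]
    _ = _ := by rw [← exp_nat_mul]; ring_nf

lemma atMostOneProb_pow_le {n k : ℕ} {p : ℝ} (h0 : 0 ≤ p) (h1 : p ≤ 1) (hk : 0 < k)
    (hkn : k ≤ n) :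
    atMostOneProb k p ^ (n - k) ≤
      exp (n * p) * exp ((n - k) * (log (1 + k * p) - k * p)) := by
  have hq : 0 ≤ 1 - p := by linarith
  have hQ : atMostOneProb k p ≤ exp (p + (log (1 + k * p) - k * p)) := by
    obtain ⟨k, rfl⟩ := Nat.exists_eq_add_of_lt hk
    have h := one_sub_pow_le_exp h1 k
    calc atMostOneProb (0 + k + 1) p = (1 - p) ^ k * (1 + k * p) := by
          simp [atMostOneProb]; ring
      _ ≤ exp (-(k * p)) * (1 + (k + 1) * p) := by
          gcongr
          linarith
      _ = _ := by
          nth_rewrite 1 [← exp_log (show 0 < 1 + (k + 1) * p by positivity)]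
          rw [← exp_add]
          push_cast
          ring_nf
  have hQ0 : 0 ≤ atMostOneProb k p := by unfold atMostOneProb; positivity
  calc atMostOneProb k p ^ (n - k) ≤ exp (p + (log (1 + k * p) - k * p)) ^ (n - k) := by gcongr
    _ = exp ((n - k) * p) * exp ((n - k) * (log (1 + k * p) - k * p)) := by
        rw [← exp_nat_mul, ← exp_add, Nat.cast_sub hkn]; ring_nf
    _ ≤ _ := by
        gcongr
        linarith [(Nat.cast_nonneg k : (0 : ℝ) ≤ k)]

lemma factorial_mul_exp_le {N : ℕ} (hN : 1 ≤ N) :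
    (N ! : ℝ) * exp N ≤ exp 1 * (N : ℝ) ^ (N + 1) := by
  induction N, hN using Nat.le_induction with
  | base => simp
  | succ N hN ih =>
    have hN' : (0 : ℝ) < N := by exact_mod_cast hN
    have h1 : exp 1 * (N : ℝ) ^ (N + 1) ≤ ((N : ℝ) + 1) ^ (N + 1) := by
      have h := one_sub_pow_le_exp (p := 1 / ((N : ℝ) + 1))
        (by rw [div_le_one (by positivity)]; linarith) (N + 1)
      have h2 : 1 - 1 / ((N : ℝ) + 1) = N / (N + 1) := by field_simp; ring
      have h3 : ((N + 1 : ℕ) : ℝ) * (1 / ((N : ℝ) + 1)) = 1 := by push_cast; field_simp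
      rw [h2, h3, div_pow, div_le_iff₀ (by positivity), exp_neg] at h
      calc exp 1 * (N : ℝ) ^ (N + 1) ≤ exp 1 * ((exp 1)⁻¹ * ((N : ℝ) + 1) ^ (N + 1)) := by gcongr
        _ = _ := by field_simp
    rw [Nat.factorial_succ]
    push_cast
    rw [exp_add]
    calc ((N : ℝ) + 1) * N ! * (exp N * exp 1) = (N + 1) * exp 1 * (N ! * exp N) := by ring
      _ ≤ (N + 1) * exp 1 * (exp 1 * (N : ℝ) ^ (N + 1)) := by gcongr
      _ ≤ (N + 1) * exp 1 * ((N : ℝ) + 1) ^ (N + 1) := by gcongr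
      _ = _ := by ring

/-- The weight `(2j)! / (j! 2 ^ j t ^ (2j)) * p ^ j` at the saddle point `t = 4`. -/
noncomputable def saddleWeight (p : ℝ) (j : ℕ) : ℝ := ((2 * j) ! : ℝ) / j ! * (p / 32) ^ j

lemma saddleWeight_succ (p : ℝ) (j : ℕ) :
    saddleWeight p (j + 1) = (2 * j + 1) * p / 16 * saddleWeight p j := by
  have h : (2 * (j + 1)) ! = (2 * j + 2) * ((2 * j + 1) * (2 * j) !) := by
    rw [show 2 * (j + 1) = 2 * j + 1 + 1 by ring, Nat.factorial_succ, Nat.factorial_succ]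
  rw [saddleWeight, saddleWeight, h, Nat.factorial_succ, pow_succ]
  push_cast
  field_simp
  ring

lemma saddleWeight_nonneg {p : ℝ} (h0 : 0 ≤ p) (j : ℕ) : 0 ≤ saddleWeight p j := by
  unfold saddleWeight; positivity

lemma saddleWeight_le_of_le {p : ℝ} (h0 : 0 ≤ p) {i j : ℕ} (hij : i ≤ j) (hj : j * p ≤ 8) :
    saddleWeight p j ≤ saddleWeight p i := by
  induction j, hij using Nat.le_induction with
  | base => rfl
  | succ j _ ih =>
    push_cast at hj
    refine le_trans ?_ (ih (by linarith))
    rw [saddleWeight_succ]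
    exact mul_le_of_le_one_left (saddleWeight_nonneg h0 j) (by linarith)

lemma saddleWeight_le_mul_add {p : ℝ} (h0 : 0 < p) (i m : ℕ) :
    saddleWeight p i ≤ (16 / p) ^ m * saddleWeight p (i + m) := by
  induction m with
  | zero => simp
  | succ m ih =>
    refine ih.trans ?_
    rw [← add_assoc, saddleWeight_succ, pow_succ]
    have h := saddleWeight_nonneg h0.le (i + m)
    calc (16 / p) ^ m * saddleWeight p (i + m)
        ≤ (16 / p) ^ m * ((2 * (i + m : ℕ) + 1) * saddleWeight p (i + m)) := by
          gcongr
          exact le_mul_of_one_le_left h (by linarith [(Nat.cast_nonneg (i + m) : (0 : ℝ) ≤ _)])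
      _ = _ := by field_simp

lemma saddleWeight_two_mul_le {p : ℝ} {k : ℕ} (h0 : 0 ≤ p) (hk : 1 ≤ k) :
    saddleWeight p (2 * k) ≤ 4 * k * exp 1 * (k * p / 4 / exp 1) ^ (2 * k) := by
  have hk' : (0 : ℝ) < k := by exact_mod_cast hk
  have h1 := factorial_mul_exp_le (N := 2 * (2 * k)) (by omega)
  have h2 := pow_div_factorial_le_exp ((2 * k : ℕ) : ℝ) (by positivity) (2 * k)
  have e1 : exp ((2 * k : ℕ) : ℝ) = exp 1 ^ (2 * k) := by rw [← exp_nat_mul, mul_one]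
  have e2 : exp ((2 * (2 * k) : ℕ) : ℝ) = (exp 1 ^ (2 * k)) ^ 2 := by
    rw [← pow_mul, ← exp_nat_mul, mul_one, mul_comm 2 (2 * k)]
  rw [e2, ← le_div_iff₀ (by positivity)] at h1
  rw [e1, div_le_iff₀ (by positivity), ← div_le_iff₀' (by positivity)] at h2
  calc saddleWeight p (2 * k)
      ≤ (exp 1 * ((2 * (2 * k) : ℕ) : ℝ) ^ (2 * (2 * k) + 1) / (exp 1 ^ (2 * k)) ^ 2) /
          (((2 * k : ℕ) : ℝ) ^ (2 * k) / exp 1 ^ (2 * k)) * (p / 32) ^ (2 * k) := by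
        unfold saddleWeight
        gcongr
    _ = 4 * k * exp 1 * ((((2 * (2 * k) : ℕ) : ℝ) ^ 2 / exp 1 ^ 2) / (((2 * k : ℕ) : ℝ) / exp 1) *
          (p / 32)) ^ (2 * k) := by
        push_cast
        simp only [mul_pow, div_pow, pow_succ, pow_mul]
        field_simp
        simp only [one_pow]
        ring
    _ = _ := by
        congr 2
        push_cast
        field_simp
        ring

lemma card_minDegTwo_mul_pow_le {n : ℕ} {S : Finset (Fin n)} {p : ℝ} {j : ℕ}
    (hk : 4 ≤ S.card) (h0 : 0 < p) (h1 : p ≤ 1) (hy : S.card * p ≤ 3 / 2)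
    (hj : 2 * S.card - 3 ≤ j) (hj' : j < 3 * S.card) :
    (minDegTwo S j).card * (p ^ j * (1 - p) ^ (S.card.choose 2 - j)) ≤
      exp (21 / 4) * (16 / p) ^ 3 * (4 * S.card * exp 1) *
        exp (S.card * (log (exp 4 - 5) + 2 * log (S.card * p / 4) - 2 - S.card * p / 2)) := by
  set k := S.card with hkdef
  have hk0 : (0 : ℝ) < k := by exact_mod_cast (by omega : 0 < k)
  have he : 0 < exp 4 - 5 := by
    linarith [add_one_lt_exp (show (4 : ℝ) ≠ 0 by norm_num)]
  have hcard : ((minDegTwo S j).card : ℝ) * p ^ j ≤ saddleWeight p j * (exp 4 - 5) ^ k := by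
    have h := card_minDegTwo_le S j (t := 4) (by norm_num)
    calc ((minDegTwo S j).card : ℝ) * p ^ j
        ≤ (2 * j)! / (j ! * 2 ^ j * 4 ^ (2 * j)) * (exp 4 - 1 - 4) ^ k * p ^ j := by gcongr
      _ = saddleWeight p j * (exp 4 - 5) ^ k := by
        rw [saddleWeight, div_pow, show (32 : ℝ) = 2 * 4 ^ 2 by norm_num, mul_pow, pow_mul,
          show exp 4 - 1 - 4 = exp 4 - 5 by ring]
        field_simp
  have hweight : saddleWeight p j ≤
      (16 / p) ^ 3 * (4 * k * exp 1 * (k * p / 4 / exp 1) ^ (2 * k)) := by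
    refine (saddleWeight_le_of_le h0.le hj ?_).trans ?_
    · have : (j : ℝ) ≤ 3 * k := by exact_mod_cast hj'.le
      nlinarith
    · refine (saddleWeight_le_mul_add h0 _ 3).trans ?_
      rw [show 2 * k - 3 + 3 = 2 * k by omega]
      gcongr
      exact saddleWeight_two_mul_le h0.le (by omega)
  have hcompl : (1 - p) ^ (k.choose 2 - j) ≤ exp (21 / 4) * exp (-(k * (k * p / 2))) := by
    refine (one_sub_pow_le_exp h1 _).trans ?_
    rw [← exp_add]
    gcongr
    have hc : (k.choose 2 : ℝ) = k * (k - 1) / 2 := Nat.cast_choose_two ℝ k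
    have h2 : (k.choose 2 : ℝ) ≤ ((k.choose 2 - j : ℕ) : ℝ) + 3 * k := by
      exact_mod_cast (by omega : k.choose 2 ≤ k.choose 2 - j + 3 * k)
    rw [hc] at h2
    nlinarith [mul_le_mul_of_nonneg_right h2 h0.le]
  have hexp : exp (k * (log (exp 4 - 5) + 2 * log (k * p / 4) - 2 - k * p / 2)) =
      (exp 4 - 5) ^ k * (k * p / 4 / exp 1) ^ (2 * k) * exp (-(k * (k * p / 2))) := by
    have hkp : 0 < k * p / 4 := by positivity
    rw [← exp_log (show 0 < k * p / 4 / exp 1 by positivity), log_div hkp.ne' (exp_pos 1).ne',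
      log_exp]
    nth_rewrite 2 [← exp_log he]
    rw [← exp_nat_mul, ← exp_nat_mul, ← exp_add, ← exp_add]
    push_cast
    ring_nf
  rw [hexp]
  calc ((minDegTwo S j).card : ℝ) * (p ^ j * (1 - p) ^ (k.choose 2 - j))
      = ((minDegTwo S j).card * p ^ j) * (1 - p) ^ (k.choose 2 - j) := by ring
    _ ≤ ((16 / p) ^ 3 * (4 * k * exp 1 * (k * p / 4 / exp 1) ^ (2 * k)) * (exp 4 - 5) ^ k) *
          (exp (21 / 4) * exp (-(k * (k * p / 2)))) := by
        have : 0 ≤ 1 - p := by linarith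
        exact mul_le_mul (hcard.trans (by gcongr)) hcompl (by positivity) (by positivity)
    _ = _ := by ring

lemma choose_three_mul_pow_le {k : ℕ} {p : ℝ} (hk : 0 < k) (h0 : 0 < p)
    (hy : k * p ≤ 3 / 2) :
    (k.choose 2).choose (3 * k) * p ^ (3 * k) ≤
      exp (k * (log (exp 4 - 5) + 2 * log (k * p / 4) - 2 - k * p / 2)) := by
  have hk0 : (0 : ℝ) < k := by exact_mod_cast hk
  have he1 := exp_one_gt_d9
  have he4 : (50 : ℝ) ≤ exp 4 := by
    have h4 : exp 4 = exp 1 ^ 4 := by rw [← exp_nat_mul]; norm_num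
    rw [h4]
    refine le_trans ?_ (pow_le_pow_left₀ (by norm_num) he1.le 4)
    norm_num
  have hlog : 15 / 4 ≤ log (exp 4 - 5) := by
    rw [le_log_iff_exp_le (by linarith), show (15 / 4 : ℝ) = 4 - 1 / 4 by norm_num, exp_sub,
      div_le_iff₀ (exp_pos _)]
    have := add_one_le_exp (1 / 4 : ℝ)
    nlinarith
  have hlog9 : 2 ≤ log 9 := by
    rw [le_log_iff_exp_le (by norm_num)]
    have h2 : exp 2 = exp 1 ^ 2 := by rw [← exp_nat_mul]; norm_num
    rw [h2]
    nlinarith [exp_one_lt_d9]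
  set y : ℝ := k * p with hydef
  have hy0 : 0 < y := by positivity
  have hkey : 3 * (1 + log (y / 6)) ≤ log (exp 4 - 5) + 2 * log (y / 4) - 2 - y / 2 := by
    have h1 : 3 * log (y / 6) - 2 * log (y / 4) + log 9 = log (y * (2 / 3)) := by
      have : y * (2 / 3) = (y / 6) ^ 3 / (y / 4) ^ 2 * 9 := by field_simp; norm_num
      rw [this, log_mul (x := _ / _) (by positivity) (by norm_num),
        log_div (x := _ ^ 3) (by positivity) (by positivity),
        log_pow, log_pow]
      norm_num
    have h2 : log (y * (2 / 3)) ≤ 0 := log_nonpos (by positivity) (by linarith)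
    linarith
  calc ((k.choose 2).choose (3 * k) : ℝ) * p ^ (3 * k)
      ≤ ((k.choose 2 : ℝ) / (3 * k : ℕ) * exp 1) ^ (3 * k) * p ^ (3 * k) := by
        gcongr
        exact choose_le_div_pow_mul_exp (by omega)
    _ = ((k.choose 2 : ℝ) / (3 * k : ℕ) * p * exp 1) ^ (3 * k) := by
        rw [← mul_pow, mul_right_comm]
    _ ≤ (y / 6 * exp 1) ^ (3 * k) := by
        gcongr
        rw [Nat.cast_choose_two, hydef]
        push_cast
        rw [show (k : ℝ) * (k - 1) / 2 / (3 * k) * p = (k - 1) * p / 6 by field_simp; ring]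
        gcongr
        linarith
    _ = exp (k * (3 * (1 + log (y / 6)))) := by
        rw [← exp_log (show 0 < y / 6 * exp 1 by positivity),
          log_mul (by positivity) (exp_pos 1).ne', log_exp, ← exp_nat_mul]
        push_cast
        ring_nf
    _ ≤ _ := by gcongr
lemma choose_mul_isRigidComponent_le_exp {n : ℕ} {c : ℝ} (hc : 4 < c) (hn : c ≤ n)
    {S : Finset (Fin n)} (hS : 4 ≤ S.card) (hSn : 10 * S.card ≤ n) :
    n.choose S.card * (erdosRenyi n (c / n)).real {G | IsRigidComponent G S} ≤
      exp c * (768 * exp (21 / 4) + 1) * n ^ 5 * exp (-(S.card / 200)) := by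
  set k := S.card with hkdef
  set p : ℝ := c / n with hpdef
  have hn0 : (0 : ℝ) < n := by linarith
  have hk0 : (0 : ℝ) < k := by exact_mod_cast (by omega : 0 < k)
  have hnk : 10 * (k : ℝ) ≤ n := by exact_mod_cast hSn
  have hk4 : (4 : ℝ) ≤ k := by exact_mod_cast hS
  have h0 : 0 < p := by positivity
  have h1 : p ≤ 1 := (div_le_one hn0).2 hn
  have hnp : n * p = c := by rw [hpdef]; field_simp
  have hr : 10 ≤ (n : ℝ) / k := by rwa [le_div_iff₀ hk0]
  have hy : 0 < k * p := by positivity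
  have hchoose : (n.choose k : ℝ) ≤ exp (k * (1 + log ((n : ℝ) / k))) :=
    choose_le_exp (by omega) (by omega)
  have hQ := atMostOneProb_pow_le h0.le h1 (by omega : 0 < k) (by omega : k ≤ n)
  have hnk' : (n : ℝ) - k = k * ((n : ℝ) / k - 1) := by field_simp
  rw [hnp, hnk'] at hQ
  have hQ0 : 0 ≤ atMostOneProb k p := by
    have : 0 ≤ 1 - p := by linarith
    unfold atMostOneProb
    positivity
  have hn5 : 1 ≤ (n : ℝ) ^ 5 := one_le_pow₀ (by linarith)
  rcases le_total (3 / 2) (k * p) with hy' | hy'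
  · have hexp := neighbour_exponent_le hr hy'
    calc (n.choose k : ℝ) * (erdosRenyi n p).real {G | IsRigidComponent G S}
        ≤ exp (k * (1 + log ((n : ℝ) / k))) *
            (exp c * exp (k * ((n : ℝ) / k - 1) * (log (1 + k * p) - k * p))) := by
          gcongr
          exact (erdosRenyi_isRigidComponent_le_atMostOneProb h0.le h1).trans hQ
      _ = exp c * exp (k * (1 + log ((n : ℝ) / k) +
            ((n : ℝ) / k - 1) * (log (1 + k * p) - k * p))) := by
          rw [mul_left_comm, ← exp_add]
          ring_nf
      _ ≤ exp c * exp (-(k / 200)) := by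
          gcongr
          nlinarith
      _ = exp c * 1 * 1 * exp (-(k / 200)) := by ring
      _ ≤ _ := by
          gcongr
          linarith [exp_pos (21 / 4 : ℝ)]
  · have hexp := component_exponent_le hr hy
    set E : ℝ := exp (k * (log (exp 4 - 5) + 2 * log (k * p / 4) - 2 - k * p / 2)) with hE
    have hsum : ∑ j ∈ Finset.Ico (2 * k - 3) (3 * k),
        (minDegTwo S j).card * (p ^ j * (1 - p) ^ (k.choose 2 - j)) ≤
          768 * exp (21 / 4) * n ^ 5 * E := by
      refine (Finset.sum_le_card_nsmul _ _ _ fun j hj => card_minDegTwo_mul_pow_le hS h0 h1 hy'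
        (Finset.mem_Ico.1 hj).1 (Finset.mem_Ico.1 hj).2).trans ?_
      rw [Nat.card_Ico, nsmul_eq_mul, ← hE]
      have hcount : ((3 * k - (2 * k - 3) : ℕ) : ℝ) ≤ n := by exact_mod_cast (by omega)
      have hp16 : 16 / p ≤ 4 * n := by
        rw [div_le_iff₀ h0]
        nlinarith
      have hke : 4 * k * exp 1 ≤ 12 * (n : ℝ) := by
        nlinarith [exp_one_lt_three]
      calc ((3 * k - (2 * k - 3) : ℕ) : ℝ) *
            (exp (21 / 4) * (16 / p) ^ 3 * (4 * k * exp 1) * E)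
          ≤ n * (exp (21 / 4) * (4 * n) ^ 3 * (12 * n) * E) := by gcongr
        _ = _ := by ring
    have hprob : (erdosRenyi n p).real {G | IsRigidComponent G S} ≤
        ((768 * exp (21 / 4) + 1) * n ^ 5 * E) *
          (exp c * exp (k * ((n : ℝ) / k - 1) * (log (1 + k * p) - k * p))) := by
      refine (erdosRenyi_isRigidComponent_le h0.le h1 hS).trans ?_
      refine mul_le_mul ?_ hQ (by positivity) (by positivity)
      have h3 := choose_three_mul_pow_le (by omega : 0 < k) h0 hy'
      rw [← hE] at h3
      have : E ≤ n ^ 5 * E := le_mul_of_one_le_left (exp_pos _).le hn5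
      linarith
    calc (n.choose k : ℝ) * (erdosRenyi n p).real {G | IsRigidComponent G S}
        ≤ exp (k * (1 + log ((n : ℝ) / k))) * (((768 * exp (21 / 4) + 1) * n ^ 5 * E) *
          (exp c * exp (k * ((n : ℝ) / k - 1) * (log (1 + k * p) - k * p)))) := by gcongr
      _ = exp c * (768 * exp (21 / 4) + 1) * n ^ 5 * (exp (k * (1 + log ((n : ℝ) / k))) *
          (E * exp (k * ((n : ℝ) / k - 1) * (log (1 + k * p) - k * p)))) := by ring
      _ ≤ _ := by
          rw [hE, ← exp_add, ← exp_add]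
          gcongr
          nlinarith

lemma choose_mul_isRigidOn_le_pow {n : ℕ} {c : ℝ} (hc : 4 < c) (hn : c ≤ n)
    {S : Finset (Fin n)} (hS : 4 ≤ S.card) :
    n.choose S.card * (erdosRenyi n (c / n)).real {G | IsRigidOn G S} ≤
      ((exp 1 * (c * exp 1 / 2) ^ 2) ^ 4 * (S.card / n)) ^ (S.card - 3) := by
  have hkn : S.card ≤ n := by simpa using S.card_le_univ
  set k := S.card with hkdef
  set a := c * exp 1 / 2 with ha
  have hn0 : (0 : ℝ) < n := by linarith
  have hk0 : (0 : ℝ) < k := by exact_mod_cast (by omega : 0 < k)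
  have hk4 : (4 : ℝ) ≤ k := by exact_mod_cast hS
  have h0 : 0 < c / n := by positivity
  have h1 : c / n ≤ 1 := (div_le_one hn0).2 hn
  have ha0 : 0 < a := by positivity
  have he1 : 1 ≤ exp 1 := one_le_exp zero_le_one
  have ha1 : 1 ≤ a := by rw [ha]; nlinarith
  have hedges : ((k.choose 2).choose (2 * k - 3) : ℝ) * (c / n) ^ (2 * k - 3) ≤
      (a * (k / n)) ^ (2 * k - 3) := by
    calc ((k.choose 2).choose (2 * k - 3) : ℝ) * (c / n) ^ (2 * k - 3)
        ≤ ((k.choose 2 : ℝ) / (2 * k - 3 : ℕ) * exp 1) ^ (2 * k - 3) * (c / n) ^ (2 * k - 3) := by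
          gcongr
          exact choose_le_div_pow_mul_exp (by omega)
      _ = ((k.choose 2 : ℝ) / (2 * k - 3 : ℕ) * (exp 1 * (c / n))) ^ (2 * k - 3) := by
          rw [← mul_pow, mul_assoc]
      _ ≤ ((k : ℝ) / 2 * (exp 1 * (c / n))) ^ (2 * k - 3) := by
          have hdens : (k.choose 2 : ℝ) / (2 * k - 3 : ℕ) ≤ k / 2 := by
            rw [Nat.cast_choose_two, Nat.cast_sub (by omega)]
            push_cast
            rw [div_le_iff₀ (by linarith)]
            nlinarith
          gcongr ?_ ^ _
          exact mul_le_mul_of_nonneg_right hdens (by positivity)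
      _ = _ := by
          rw [ha]
          congr 1
          field_simp
  have hB : exp 1 ^ k * a ^ (2 * k - 3) ≤ ((exp 1 * a ^ 2) ^ 4) ^ (k - 3) := by
    calc exp 1 ^ k * a ^ (2 * k - 3) ≤ exp 1 ^ k * a ^ (2 * k) := by
          gcongr
          omega
      _ = (exp 1 * a ^ 2) ^ k := by rw [mul_pow, pow_mul]
      _ ≤ (exp 1 * a ^ 2) ^ (4 * (k - 3)) := by
          gcongr
          · exact one_le_mul_of_one_le_of_one_le he1 (one_le_pow₀ ha1)
          · omega
      _ = _ := by rw [pow_mul]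
  calc (n.choose k : ℝ) * (erdosRenyi n (c / n)).real {G | IsRigidOn G S}
      ≤ ((n : ℝ) / k * exp 1) ^ k * (a * (k / n)) ^ (2 * k - 3) := by
        gcongr
        · exact choose_le_div_pow_mul_exp (by omega)
        · exact (erdosRenyi_isRigidOn_le h0.le h1 hS).trans hedges
    _ = exp 1 ^ k * a ^ (2 * k - 3) * ((k : ℝ) / n) ^ (k - 3) := by
        obtain ⟨m, hm⟩ := Nat.exists_eq_add_of_le hS
        rw [hm, show 2 * (4 + m) - 3 = (4 + m) + (1 + m) by omega, show 4 + m - 3 = 1 + m by omega,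
          ← hm, mul_pow, mul_pow, pow_add ((k : ℝ) / n)]
        have : ((n : ℝ) / k) ^ k * ((k : ℝ) / n) ^ k = 1 := by
          rw [← mul_pow, div_mul_div_comm, mul_comm (n : ℝ), div_self (by positivity), one_pow]
        linear_combination (exp 1 ^ k * a ^ (k + (1 + m)) * ((k : ℝ) / n) ^ (1 + m)) * this
    _ ≤ _ := by
        rw [mul_pow]
        gcongr

lemma exists_small_isRigidComponent_le {n : ℕ} {c : ℝ} (hc : 4 < c) (hn : c ≤ n) {β : ℕ → ℝ}
    (hβ0 : ∀ k, 0 ≤ β k) (hβ : ∀ S : Finset (Fin n), 4 ≤ S.card → 10 * S.card ≤ n →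
      n.choose S.card * (erdosRenyi n (c / n)).real {G | IsRigidComponent G S} ≤ β S.card) :
    (erdosRenyi n (c / n)).real
        {G | ∃ S, IsRigidComponent G S ∧ 4 ≤ S.card ∧ 10 * S.card ≤ n} ≤
      ∑ k ∈ Finset.range (n + 1), β k := by
  have hn0 : (0 : ℝ) < n := by linarith
  have := isProbabilityMeasure_erdosRenyi (n := n) (p := c / n) (by positivity)
    ((div_le_one hn0).2 hn)
  have hset : {G : SimpleGraph (Fin n) | ∃ S, IsRigidComponent G S ∧ 4 ≤ S.card ∧ 10 * S.card ≤ n} =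
      ⋃ S ∈ Finset.univ.powerset.filter (fun S : Finset (Fin n) => 4 ≤ S.card ∧ 10 * S.card ≤ n),
        {G | IsRigidComponent G S} := by
    ext G
    simp [and_comm]
  rw [hset]
  refine (measureReal_biUnion_finset_le _ _).trans ?_
  calc ∑ S ∈ Finset.univ.powerset.filter (fun S : Finset (Fin n) => 4 ≤ S.card ∧ 10 * S.card ≤ n),
        (erdosRenyi n (c / n)).real {G | IsRigidComponent G S}
      ≤ ∑ S ∈ Finset.univ.powerset.filter
          (fun S : Finset (Fin n) => 4 ≤ S.card ∧ 10 * S.card ≤ n),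
          β S.card / n.choose S.card := by
        refine Finset.sum_le_sum fun S hS => ?_
        have hS' := (Finset.mem_filter.1 hS).2
        have hpos : 0 < n.choose S.card := Nat.choose_pos (by omega)
        rw [le_div_iff₀' (by exact_mod_cast hpos)]
        exact hβ S hS'.1 hS'.2
    _ ≤ ∑ S ∈ (Finset.univ : Finset (Fin n)).powerset, β S.card / n.choose S.card :=
        Finset.sum_le_sum_of_subset_of_nonneg (Finset.filter_subset _ _)
          fun S _ _ => div_nonneg (hβ0 _) (Nat.cast_nonneg _)
    _ = ∑ k ∈ Finset.range (n + 1), β k := by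
        rw [Finset.sum_powerset_apply_card (fun k => β k / n.choose k), Finset.card_univ,
          Fintype.card_fin]
        refine Finset.sum_congr rfl fun k hk => ?_
        have hpos : 0 < n.choose k := Nat.choose_pos (by simpa [Nat.lt_succ_iff] using hk)
        rw [nsmul_eq_mul, mul_div_cancel₀]
        exact_mod_cast hpos.ne'

lemma tendsto_exists_small_isRigidComponent {c : ℝ} (hc : 4 < c) :
    Tendsto (fun n : ℕ => (erdosRenyi n (c / n)).real
      {G | ∃ S, IsRigidComponent G S ∧ 4 ≤ S.card ∧ 10 * S.card ≤ n}) atTop (nhds 0) := by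
  set B : ℝ := (exp 1 * (c * exp 1 / 2) ^ 2) ^ 4 with hB
  set K : ℝ := exp c * (768 * exp (21 / 4) + 1) with hK
  set D : ℝ := ∑' k : ℕ, (k : ℝ) ^ 1 * (1 / 2) ^ k with hD
  have hB0 : 0 < B := by positivity
  have hK0 : 0 < K := by positivity
  have hsummable : Summable fun k : ℕ => (k : ℝ) ^ 1 * (1 / 2 : ℝ) ^ k :=
    summable_pow_mul_geometric_of_norm_lt_one 1 (by norm_num)
  have hbound : ∀ n : ℕ, c ≤ n → (erdosRenyi n (c / n)).real
      {G | ∃ S, IsRigidComponent G S ∧ 4 ≤ S.card ∧ 10 * S.card ≤ n} ≤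
        16 * B * D / n + 2 * K * ((n : ℝ) ^ 6 / exp (1 / (400 * B) * n)) := by
    intro n hn
    have hn1 : (1 : ℝ) ≤ n := by linarith
    have := isProbabilityMeasure_erdosRenyi (n := n) (p := c / n) (by positivity)
      ((div_le_one (by linarith)).2 hn)
    set ε : ℝ := K * n ^ 5 * exp (-(1 / (400 * B) * n)) with hε
    refine (exists_small_isRigidComponent_le hc hn
      (β := fun k => 16 * B / n * ((k : ℝ) ^ 1 * (1 / 2) ^ k) + ε) (fun k => by positivity)
      fun S hS hSn => ?_).trans ?_
    · rcases le_total (B * (S.card / n)) (1 / 2) with hsmall | hlarge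
      · refine le_trans ?_ (le_add_of_nonneg_right (by positivity))
        refine le_trans ?_ ((choose_mul_isRigidOn_le_pow hc hn hS).trans ?_)
        · gcongr
          · exact measure_ne_top _ _
          · exact fun hG => hG.2.1
        · rw [← hB]
          obtain ⟨m, hm⟩ := Nat.exists_eq_add_of_le hS
          calc (B * (S.card / n)) ^ (S.card - 3)
              = (B * (S.card / n)) * (B * (S.card / n)) ^ m := by
                rw [show S.card - 3 = m + 1 by omega, pow_succ']
            _ ≤ (B * (S.card / n)) * (1 / 2) ^ m := by gcongr
            _ = 16 * B / n * ((S.card : ℝ) ^ 1 * (1 / 2) ^ S.card) := by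
                nth_rewrite 3 [hm]
                rw [pow_add]
                ring
      · refine le_trans ?_ (le_add_of_nonneg_left (by positivity))
        refine (choose_mul_isRigidComponent_le_exp hc hn hS hSn).trans ?_
        rw [hε, hK]
        gcongr
        rw [← mul_div_assoc, le_div_iff₀ (by linarith)] at hlarge
        rw [div_mul_eq_mul_div, div_le_iff₀ (by positivity)]
        linarith
    · rw [Finset.sum_add_distrib, ← Finset.mul_sum, Finset.sum_const, Finset.card_range,
        nsmul_eq_mul]
      have hsum : ∑ k ∈ Finset.range (n + 1), (k : ℝ) ^ 1 * (1 / 2 : ℝ) ^ k ≤ D :=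
        hsummable.sum_le_tsum _ fun k _ => by positivity
      have hcount : ((n + 1 : ℕ) : ℝ) ≤ 2 * n := by push_cast; linarith
      calc 16 * B / n * ∑ k ∈ Finset.range (n + 1), (k : ℝ) ^ 1 * (1 / 2 : ℝ) ^ k +
            (n + 1 : ℕ) * ε ≤ 16 * B / n * D + 2 * n * ε := by gcongr
        _ = _ := by rw [hε, exp_neg]; ring
  have hlim1 : Tendsto (fun n : ℕ => 16 * B * D / n) atTop (nhds 0) :=
    tendsto_const_div_atTop_nhds_zero_nat _
  have hlim2 : Tendsto (fun n : ℕ => (n : ℝ) ^ 6 / exp (1 / (400 * B) * n)) atTop (nhds 0) :=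
    ((isLittleO_pow_exp_pos_mul_atTop 6 (by positivity)).tendsto_div_nhds_zero).comp
      tendsto_natCast_atTop_atTop
  have hlim := hlim1.add (hlim2.const_mul (2 * K))
  simp only [mul_zero, add_zero] at hlim
  refine tendsto_of_tendsto_of_tendsto_of_le_of_le' tendsto_const_nhds hlim
    (Eventually.of_forall fun n => measureReal_nonneg) ?_
  filter_upwards [tendsto_natCast_atTop_atTop.eventually_ge_atTop c] with n hn using hbound n hn

lemma tendsto_ncard_edgeSet_le {c : ℝ} (hc : 4 < c) :
    Tendsto (fun n : ℕ => (erdosRenyi n (c / n)).real {G | G.edgeSet.ncard ≤ 2 * n})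
      atTop (nhds 0) := by
  set δ : ℝ := c / 4 - 1 - log (c / 4) with hδ
  have hc0 : 0 < c := by linarith
  have hδ0 : 0 < δ := by
    have := log_lt_sub_one_of_pos (show 0 < c / 4 by positivity) (by linarith)
    linarith
  have hbound : ∀ n : ℕ, c ≤ n → (erdosRenyi n (c / n)).real {G | G.edgeSet.ncard ≤ 2 * n} ≤
      exp (c / 2 - 2 + (-(2 * δ)) * n) := by
    intro n hn
    have hn0 : (0 : ℝ) < n := by linarith
    refine (erdosRenyi_ncard_edgeSet_le (by positivity) ((div_le_one hn0).2 hn) (2 * n)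
      (z := 4 / c) (by positivity) ((div_le_one hc0).2 hc.le)).trans ?_
    have hpow : (4 / c)⁻¹ ^ (2 * n) = exp ((2 * n : ℕ) * log (c / 4)) := by
      rw [exp_nat_mul, exp_log (by positivity), inv_div]
    have hbase : 4 / c * (c / n) + (1 - c / n) = 1 - (c - 4) / n := by field_simp; ring
    have hle : (c - 4) / n ≤ 1 := by rw [div_le_one hn0]; linarith
    rw [hpow, hbase]
    refine (mul_le_mul_of_nonneg_left (one_sub_pow_le_exp hle _) (exp_pos _).le).trans ?_
    rw [← exp_add, Nat.cast_choose_two]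
    rw [exp_le_exp]
    have : (n : ℝ) * (n - 1) / 2 * ((c - 4) / n) = (n - 1) * (c - 4) / 2 := by field_simp
    rw [this, hδ]
    push_cast
    linarith
  refine tendsto_of_tendsto_of_tendsto_of_le_of_le' tendsto_const_nhds
    (h := fun n : ℕ => exp (c / 2 - 2 + (-(2 * δ)) * n)) ?_
    (Eventually.of_forall fun n => measureReal_nonneg) ?_
  · refine tendsto_exp_atBot.comp (tendsto_atBot_add_const_left _ _ ?_)
    exact tendsto_natCast_atTop_atTop.const_mul_atTop_of_neg (by linarith)
  · filter_upwards [tendsto_natCast_atTop_atTop.eventually_ge_atTop c] with n hn using hbound n hn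

end Asymptotics

/-- For a fixed constant `c > 4`, almost surely every rigid component of `G(n, c/n)`
spanning at least 4 vertices spans at least `n/10` vertices, and at least one such
component exists. -/
theorem nontrivial_components_span_tenth (c : ℝ) (hc : 4 < c) :
    Tendsto (fun n : ℕ =>
      erdosRenyi n (c / n)
        {G | (∀ S : Finset (Fin n), IsRigidComponent G S → 4 ≤ S.card →
                (n : ℝ) / 10 ≤ (S.card : ℝ)) ∧
             (∃ S : Finset (Fin n), IsRigidComponent G S ∧ 4 ≤ S.card)})
      atTop (nhds 1) := by
  have hlim := ENNReal.tendsto_ofReal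
    ((tendsto_exists_small_isRigidComponent hc).add (tendsto_ncard_edgeSet_le hc))
  rw [add_zero, ENNReal.ofReal_zero] at hlim
  have hsub := ENNReal.Tendsto.sub (tendsto_const_nhds (x := (1 : ENNReal))) hlim
    (Or.inl ENNReal.one_ne_top)
  rw [tsub_zero] at hsub
  have hprob : ∀ᶠ n : ℕ in atTop, 2 ≤ n ∧ IsProbabilityMeasure (erdosRenyi n (c / n)) := by
    filter_upwards [tendsto_natCast_atTop_atTop.eventually_ge_atTop c, eventually_ge_atTop 2]
      with n hn hn2
    have hn0 : (0 : ℝ) < n := by linarith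
    exact ⟨hn2, isProbabilityMeasure_erdosRenyi (by positivity) ((div_le_one hn0).2 hn)⟩
  refine tendsto_of_tendsto_of_tendsto_of_le_of_le' hsub tendsto_const_nhds ?_ ?_
  · filter_upwards [hprob] with n hn
    obtain ⟨hn2, hn⟩ := hn
    set small : Set (SimpleGraph (Fin n)) :=
      {G | ∃ S, IsRigidComponent G S ∧ 4 ≤ S.card ∧ 10 * S.card ≤ n}
    set sparse : Set (SimpleGraph (Fin n)) := {G | G.edgeSet.ncard ≤ 2 * n}
    have hmeas : MeasurableSet (small ∪ sparse) := trivial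
    calc 1 - ENNReal.ofReal ((erdosRenyi n (c / n)).real small + (erdosRenyi n (c / n)).real sparse)
        ≤ 1 - erdosRenyi n (c / n) (small ∪ sparse) := by
          rw [ENNReal.ofReal_add measureReal_nonneg measureReal_nonneg, ofReal_measureReal,
            ofReal_measureReal]
          exact tsub_le_tsub_left (measure_union_le _ _) _
      _ = erdosRenyi n (c / n) (small ∪ sparse)ᶜ := (prob_compl_eq_one_sub hmeas).symm
      _ ≤ _ := by
          refine measure_mono fun G hG => ⟨fun S hS h4 => ?_, ?_⟩
          · by_contra! hlt
            rw [lt_div_iff₀ (by norm_num)] at hlt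
            have : S.card * 10 < n := by exact_mod_cast hlt
            exact hG (Or.inl ⟨S, hS, h4, by omega⟩)
          · refine exists_isRigidComponent_of_lt_ncard hn2 ?_
            have : ¬ G.edgeSet.ncard ≤ 2 * n := fun h => hG (Or.inr h)
            omega
  · filter_upwards [hprob] with n hn
    have := hn.2
    exact prob_le_one
end

section
/- Let a > 1 and c > 0 be fixed real constants, and let ε be a constant with 0 < ε < min{ 2a(1−1/a)/(a+3), 1/2 }. Then the probability that the Erdős–Rényi random graph G(n, c/n) contains some vertex set S with 2 ≤ |S| ≤ n^ε spanning at least a·|S| edges tends to 0 as n → ∞. -/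
open MeasureTheory Filter

/-- A product of Bernoulli(p) measures gives at most `choose |T| m * p ^ m` mass to the
configurations with at least `m` successes inside `T`. -/
lemma pi_bernoulliMeasure_le_card_le {ι : Type*} [Fintype ι] [DecidableEq ι] {p : ℝ}
    (hp0 : 0 ≤ p) (hp1 : p ≤ 1) (T : Finset ι) (m : ℕ) :
    Measure.pi (fun _ : ι => bernoulliMeasure p) {f | m ≤ (T.filter fun i => f i = true).card} ≤
      ENNReal.ofReal (T.card.choose m * p ^ m) := by
  have huniv : bernoulliMeasure p Set.univ = 1 := by
    simp only [bernoulliMeasure, Measure.add_apply, Measure.smul_apply, measure_univ, smul_eq_mul,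
      mul_one]
    rw [← ENNReal.ofReal_add hp0 (by linarith)]
    simp
  have : IsProbabilityMeasure (bernoulliMeasure p) := ⟨huniv⟩
  have htrue : bernoulliMeasure p {true} = ENNReal.ofReal p := by
    simp [bernoulliMeasure]
  have hF (F : Finset ι) : Measure.pi (fun _ : ι => bernoulliMeasure p)
      {f | ∀ i ∈ F, f i = true} = ENNReal.ofReal (p ^ F.card) := by
    have : {f : ι → Bool | ∀ i ∈ F, f i = true} =
        Set.univ.pi fun i => if i ∈ F then {true} else Set.univ := by
      ext f
      simp only [Set.mem_ofPred_eq, Set.mem_pi, Set.mem_univ, true_imp_iff]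
      refine forall_congr' fun i => ?_
      split_ifs with h <;> simp [h]
    rw [this, Measure.pi_pi, ENNReal.ofReal_pow hp0]
    simp only [apply_ite (bernoulliMeasure p), htrue, huniv]
    rw [Finset.prod_ite_mem]
    simp
  calc _ ≤ Measure.pi (fun _ : ι => bernoulliMeasure p)
        (⋃ F ∈ T.powersetCard m, {f | ∀ i ∈ F, f i = true}) := by
        refine measure_mono fun f hf => ?_
        obtain ⟨F, hFs, hFc⟩ := Finset.exists_subset_card_eq (Set.mem_ofPred_eq ▸ hf)
        simp only [Set.mem_iUnion, Finset.mem_powersetCard]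
        exact ⟨F, ⟨hFs.trans (Finset.filter_subset _ _), hFc⟩,
          fun i hi => (Finset.mem_filter.1 (hFs hi)).2⟩
    _ ≤ ∑ F ∈ T.powersetCard m, Measure.pi (fun _ : ι => bernoulliMeasure p)
        {f | ∀ i ∈ F, f i = true} := measure_biUnion_finset_le _ _
    _ = ∑ F ∈ T.powersetCard m, ENNReal.ofReal (p ^ m) :=
        Finset.sum_congr rfl fun F h => by rw [hF, (Finset.mem_powersetCard.1 h).2]
    _ = _ := by
        rw [Finset.sum_const, Finset.card_powersetCard, nsmul_eq_mul,
          ENNReal.ofReal_mul (by positivity), ENNReal.ofReal_natCast]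

/-- The probability that a fixed vertex set `S` spans at least `m` edges of `G(n,p)`. -/
lemma erdosRenyi_le_ncard_spannedEdges {n : ℕ} {p : ℝ} (hp0 : 0 ≤ p) (hp1 : p ≤ 1)
    (S : Finset (Fin n)) (m : ℕ) :
    erdosRenyi n p {G | m ≤ (spannedEdges G S).ncard} ≤
      ENNReal.ofReal ((S.card ^ 2).choose m * p ^ m) := by
  classical
  let T : Finset {e : Sym2 (Fin n) // ¬ e.IsDiag} := Finset.univ.filter fun e => ∀ v ∈ e.1, v ∈ S
  have hT : T.card ≤ S.card ^ 2 := by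
    calc T.card = (T.map (Function.Embedding.subtype _)).card := (Finset.card_map _).symm
      _ ≤ S.sym2.card := by
        refine Finset.card_le_card fun e he => ?_
        simp only [T, Finset.mem_map, Finset.mem_filter, Finset.mem_univ, true_and] at he
        obtain ⟨e', he', rfl⟩ := he
        exact Finset.mem_sym2_iff.2 he'
      _ ≤ S.card ^ 2 := by
        rw [Finset.card_sym2, Nat.choose_two_right, Nat.add_sub_cancel]
        refine Nat.div_le_of_le_mul ?_
        rcases Nat.eq_zero_or_pos S.card with h | h
        · simp [h]
        · nlinarith
  rw [erdosRenyi, Measure.map_apply (measurable_of_finite _) MeasurableSpace.measurableSet_top]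
  calc _ ≤ Measure.pi (fun _ => bernoulliMeasure p)
        {f | m ≤ (T.filter fun i => f i = true).card} := by
        refine measure_mono fun f hf => ?_
        simp only [Set.mem_preimage, Set.mem_ofPred_eq] at hf ⊢
        refine hf.trans ?_
        rw [← Finset.card_map (Function.Embedding.subtype _), ← Set.ncard_coe_finset]
        refine Set.ncard_le_ncard (fun e he => ?_) (Finset.finite_toSet _)
        simp only [spannedEdges, SimpleGraph.edgeSet_fromEdgeSet, Set.mem_ofPred_eq,
          Set.mem_sdiff] at he
        obtain ⟨⟨⟨h, hfe⟩, -⟩, hS⟩ := he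
        simp only [Finset.coe_map, Set.mem_image, Finset.mem_coe, Finset.mem_filter]
        exact ⟨⟨e, h⟩, ⟨Finset.mem_filter.2 ⟨Finset.mem_univ _, hS⟩, hfe⟩, rfl⟩
    _ ≤ _ := pi_bernoulliMeasure_le_card_le hp0 hp1 T m
    _ ≤ _ := by gcongr

lemma choose_le_exp_mul_div_pow (N m : ℕ) :
    (N.choose m : ℝ) ≤ (Real.exp 1 * N / m) ^ m := by
  rcases Nat.eq_zero_or_pos m with rfl | hm
  · simp
  have h := Real.pow_div_factorial_le_exp (m : ℝ) (by positivity) m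
  calc (N.choose m : ℝ) ≤ (N : ℝ) ^ m / m.factorial := Nat.choose_le_pow_div m N
    _ = (N / m : ℝ) ^ m * ((m : ℝ) ^ m / m.factorial) := by
      rw [div_pow]
      field_simp
    _ ≤ (N / m : ℝ) ^ m * Real.exp m := by gcongr
    _ = (Real.exp 1 * N / m) ^ m := by
      rw [← Real.exp_one_pow, ← mul_pow]
      ring

/-- The union bound over vertex sets of size `s` for the existence of one spanning at least
`a * s` edges in `G(n, c/n)`. -/
lemma choose_mul_choose_mul_pow_le {a c ε : ℝ} (ha : 1 < a) (hc : 0 < c) {n s : ℕ} (hn : 0 < n)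
    (hs : 0 < s) (hsn : (s : ℝ) ≤ (n : ℝ) ^ ε)
    (hsmall : Real.exp 1 * c * (n : ℝ) ^ (ε - 1) ≤ 1) :
    (n.choose s : ℝ) * ((s ^ 2).choose ⌈a * s⌉₊ * (c / n) ^ ⌈a * s⌉₊) ≤
      (Real.exp 1 * (Real.exp 1 * c) ^ a * ((n : ℝ) ^ (ε - 1)) ^ (a - 1)) ^ s := by
  have hn' : (0 : ℝ) < n := by exact_mod_cast hn
  have hs' : (0 : ℝ) < s := by exact_mod_cast hs
  set m := ⌈a * s⌉₊ with hm
  have ham : a * s ≤ m := Nat.le_ceil _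
  have hsm : (s : ℝ) ≤ m := by nlinarith
  have hm' : (0 : ℝ) < m := by linarith
  have hratio : (s : ℝ) / n ≤ (n : ℝ) ^ (ε - 1) := by
    rw [Real.rpow_sub_one hn'.ne']
    gcongr
  set q : ℝ := Real.exp 1 * c * (s / n) with hq
  have hq0 : 0 < q := by positivity
  have hq1 : q ≤ 1 := le_trans (by rw [hq]; gcongr) hsmall
  have hedge : ((s ^ 2).choose m : ℝ) * (c / n) ^ m ≤ (q ^ a) ^ s := by
    calc ((s ^ 2).choose m : ℝ) * (c / n) ^ m
        ≤ (Real.exp 1 * (s ^ 2 : ℕ) / m) ^ m * (c / n) ^ m := by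
          gcongr
          exact choose_le_exp_mul_div_pow _ _
      _ = (q * (s / m)) ^ m := by
          rw [← mul_pow, hq]
          push_cast
          congr 1
          field_simp
      _ ≤ q ^ m := by
          gcongr
          exact mul_le_of_le_one_right hq0.le ((div_le_one hm').2 hsm)
      _ = q ^ (m : ℝ) := (Real.rpow_natCast _ _).symm
      _ ≤ q ^ (a * s) := Real.rpow_le_rpow_of_exponent_ge hq0 hq1 ham
      _ = (q ^ a) ^ s := Real.rpow_mul_natCast hq0.le _ _
  calc (n.choose s : ℝ) * ((s ^ 2).choose m * (c / n) ^ m)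
      ≤ (Real.exp 1 * n / s) ^ s * (q ^ a) ^ s := by
        gcongr
        exact choose_le_exp_mul_div_pow _ _
    _ = (Real.exp 1 * (Real.exp 1 * c) ^ a * ((s : ℝ) / n) ^ (a - 1)) ^ s := by
        rw [← mul_pow, hq, Real.mul_rpow (by positivity) (by positivity),
          Real.rpow_sub_one (by positivity)]
        congr 1
        field_simp
    _ ≤ _ := by
        have : 0 ≤ a - 1 := by linarith
        gcongr

lemma sum_range_pow_succ_le_two_mul {x : ℝ} (hx0 : 0 ≤ x) (hx : x ≤ 1 / 2) (n : ℕ) :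
    ∑ s ∈ Finset.range n, x ^ (s + 1) ≤ 2 * x := by
  have hx1 : x < 1 := by linarith
  simp only [pow_succ']
  rw [← Finset.mul_sum, mul_comm 2]
  gcongr
  calc ∑ s ∈ Finset.range n, x ^ s ≤ ∑' s, x ^ s :=
        (summable_geometric_of_lt_one hx0 hx1).sum_le_tsum _ fun _ _ => by positivity
    _ = (1 - x)⁻¹ := tsum_geometric_of_lt_one hx0 hx1
    _ ≤ 2 := inv_le_of_inv_le₀ (by norm_num) (by linarith)

lemma erdosRenyi_exists_dense_le {a c ε x : ℝ} (ha : 1 < a) (hc : 0 < c) {n : ℕ} (hn : 0 < n)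
    (hcn : c ≤ n) (hsmall : Real.exp 1 * c * (n : ℝ) ^ (ε - 1) ≤ 1)
    (hx : x = Real.exp 1 * (Real.exp 1 * c) ^ a * ((n : ℝ) ^ (ε - 1)) ^ (a - 1))
    (hx2 : x ≤ 1 / 2) :
    erdosRenyi n (c / n)
        {G | ∃ S : Finset (Fin n), 2 ≤ S.card ∧ (S.card : ℝ) ≤ (n : ℝ) ^ ε ∧
          a * S.card ≤ ((spannedEdges G S).ncard : ℝ)} ≤ ENNReal.ofReal (2 * x) := by
  classical
  have hn' : (0 : ℝ) < n := by exact_mod_cast hn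
  have hx0 : 0 ≤ x := by rw [hx]; positivity
  have hp0 : 0 ≤ c / n := by positivity
  have hp1 : c / n ≤ 1 := (div_le_one hn').2 hcn
  let g : ℕ → ℝ := fun s => if 2 ≤ s ∧ (s : ℝ) ≤ (n : ℝ) ^ ε then
    (s ^ 2).choose ⌈a * s⌉₊ * (c / n) ^ ⌈a * s⌉₊ else 0
  have hg0 (s : ℕ) : 0 ≤ g s := by
    simp only [g]
    split_ifs <;> positivity
  have hg (s : ℕ) : n.choose (s + 1) * g (s + 1) ≤ x ^ (s + 1) := by
    simp only [g]
    split_ifs with h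
    · rw [hx]
      exact choose_mul_choose_mul_pow_le ha hc hn s.succ_pos h.2 hsmall
    · rw [mul_zero]
      positivity
  calc _ ≤ erdosRenyi n (c / n) (⋃ S ∈ (Finset.univ : Finset (Finset (Fin n))),
        {G | 2 ≤ S.card ∧ (S.card : ℝ) ≤ (n : ℝ) ^ ε ∧
          a * S.card ≤ ((spannedEdges G S).ncard : ℝ)}) := by
        refine measure_mono fun G hG => ?_
        simpa using hG
    _ ≤ ∑ S : Finset (Fin n), erdosRenyi n (c / n)
        {G | 2 ≤ S.card ∧ (S.card : ℝ) ≤ (n : ℝ) ^ ε ∧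
          a * S.card ≤ ((spannedEdges G S).ncard : ℝ)} := measure_biUnion_finset_le _ _
    _ ≤ ∑ S : Finset (Fin n), ENNReal.ofReal (g S.card) := by
        refine Finset.sum_le_sum fun S _ => ?_
        by_cases h : 2 ≤ S.card ∧ (S.card : ℝ) ≤ (n : ℝ) ^ ε
        · simp only [g, if_pos h]
          refine le_trans (measure_mono fun G hG => ?_)
            (erdosRenyi_le_ncard_spannedEdges hp0 hp1 S ⌈a * S.card⌉₊)
          exact Nat.ceil_le.2 hG.2.2
        · have : {G : SimpleGraph (Fin n) | 2 ≤ S.card ∧ (S.card : ℝ) ≤ (n : ℝ) ^ ε ∧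
              a * S.card ≤ ((spannedEdges G S).ncard : ℝ)} = ∅ :=
            Set.eq_empty_of_forall_notMem fun G hG => h ⟨hG.1, hG.2.1⟩
          rw [this, measure_empty]
          exact zero_le
    _ = ENNReal.ofReal (∑ S : Finset (Fin n), g S.card) :=
        (ENNReal.ofReal_sum_of_nonneg fun _ _ => hg0 _).symm
    _ ≤ ENNReal.ofReal (2 * x) := by
        refine ENNReal.ofReal_le_ofReal ?_
        rw [← Finset.powerset_univ, Finset.sum_powerset_apply_card, Finset.card_univ,
          Fintype.card_fin, Finset.sum_range_succ']
        simp only [nsmul_eq_mul]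
        have h0 : g 0 = 0 := by simp [g]
        rw [h0, mul_zero, add_zero]
        exact (Finset.sum_le_sum fun s _ => hg s).trans (sum_range_pow_succ_le_two_mul hx0 hx2 n)

/-- For fixed `a > 1`, `c > 0` and `0 < ε < min(2a(1-1/a)/(a+3), 1/2)`, the probability
that `G(n, c/n)` contains some vertex set `S` with `2 ≤ |S| ≤ n^ε` spanning at least
`a·|S|` edges tends to 0 as `n → ∞`. -/
theorem small_dense_sets_vanish (a c ε : ℝ) (ha : 1 < a) (hc : 0 < c)
    (hε0 : 0 < ε) (hε : ε < min (2 * a * (1 - 1 / a) / (a + 3)) (1 / 2)) :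
    Tendsto (fun n : ℕ =>
      erdosRenyi n (c / n)
        {G | ∃ S : Finset (Fin n), 2 ≤ S.card ∧ (S.card : ℝ) ≤ (n : ℝ) ^ ε ∧
          a * S.card ≤ ((spannedEdges G S).ncard : ℝ)})
      atTop (nhds 0) := by
  have hε1 : ε < 1 / 2 := hε.trans_le (min_le_right _ _)
  have hpow : Tendsto (fun n : ℕ => (n : ℝ) ^ (ε - 1)) atTop (nhds 0) := by
    have := (tendsto_rpow_neg_atTop (y := 1 - ε) (by linarith)).comp
      (tendsto_natCast_atTop_atTop (R := ℝ))
    simpa [Function.comp_def] using this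
  have hx : Tendsto (fun n : ℕ => Real.exp 1 * (Real.exp 1 * c) ^ a *
      ((n : ℝ) ^ (ε - 1)) ^ (a - 1)) atTop (nhds 0) := by
    have := (hpow.rpow_const (p := a - 1) (Or.inr (by linarith))).const_mul
      (Real.exp 1 * (Real.exp 1 * c) ^ a)
    rwa [Real.zero_rpow (by linarith), mul_zero] at this
  have hsmall : Tendsto (fun n : ℕ => Real.exp 1 * c * (n : ℝ) ^ (ε - 1)) atTop (nhds 0) := by
    simpa using hpow.const_mul (Real.exp 1 * c)
  have hbound := ENNReal.tendsto_ofReal (hx.const_mul 2)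
  rw [mul_zero, ENNReal.ofReal_zero] at hbound
  refine tendsto_of_tendsto_of_tendsto_of_le_of_le' tendsto_const_nhds hbound
    (Eventually.of_forall fun _ => zero_le) ?_
  filter_upwards [eventually_gt_atTop 0, tendsto_natCast_atTop_atTop.eventually_ge_atTop c,
    hsmall.eventually_le_const one_pos, hx.eventually_le_const one_half_pos] with n h1 h2 h3 h4
  exact erdosRenyi_exists_dense_le ha hc h1 h2 h3 rfl h4
end

section
/- For s = 1/10, the real number e^{s} · ( e^{1/s − 1} · (1/s)^{−1/s} )^{2s²} · (1/s)^{s} · ( e^{−4s} · (4s+1) )^{1−s} equals 2^{−1/10} · 5^{−1} · 7^{9/10} · e^{−2/25}, and this quantity is strictly less than 1. -/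
/-- For `s = 1/10`, the per-`n` root of the expected-count bound
`e^s · (e^(1/s-1)·(1/s)^(-1/s))^(2s²) · (1/s)^s · (e^(-4s)·(4s+1))^(1-s)`
equals `2^(-1/10) · 5⁻¹ · 7^(9/10) · e^(-2/25)`, which is strictly less than 1. -/
theorem expected_count_base_lt_one (s : ℝ) (hs : s = 1 / 10) :
    Real.exp s * (Real.exp (1 / s - 1) * (1 / s) ^ (-(1 / s))) ^ (2 * s ^ 2) *
        (1 / s) ^ s * (Real.exp (-(4 * s)) * (4 * s + 1)) ^ (1 - s) =
      (2 : ℝ) ^ (-(1 / 10) : ℝ) * (5 : ℝ)⁻¹ * (7 : ℝ) ^ ((9 : ℝ) / 10) *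
        Real.exp (-(2 / 25)) ∧
    (2 : ℝ) ^ (-(1 / 10) : ℝ) * (5 : ℝ)⁻¹ * (7 : ℝ) ^ ((9 : ℝ) / 10) *
        Real.exp (-(2 / 25)) < 1 := by
  subst hs
  have h10 : Real.log 10 = Real.log 2 + Real.log 5 := by
    rw [← Real.log_mul (by norm_num) (by norm_num)]; norm_num
  have h75 : Real.log (7 / 5) = Real.log 7 - Real.log 5 :=
    Real.log_div (by norm_num) (by norm_num)
  have h5 : (5 : ℝ)⁻¹ = Real.exp (-Real.log 5) := by
    rw [Real.exp_neg, Real.exp_log (by norm_num)]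
  have hs : (1 : ℝ) / (1 / 10) = 10 := by norm_num
  have h7 : (4 : ℝ) * (1 / 10) + 1 = Real.exp (Real.log 7 - Real.log 5) := by
    rw [← h75, Real.exp_log (by norm_num)]; norm_num
  constructor
  · rw [hs, h7, h5, Real.rpow_def_of_pos (show (0 : ℝ) < 10 by norm_num),
      Real.rpow_def_of_pos (show (0 : ℝ) < 10 by norm_num),
      Real.rpow_def_of_pos (show (0 : ℝ) < 2 by norm_num),
      Real.rpow_def_of_pos (show (0 : ℝ) < 7 by norm_num), h10]
    simp only [← Real.exp_add, ← Real.exp_mul]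
    congr 1
    ring
  · have h_exp : (7 : ℝ) ^ 9 / (2 * 5 ^ 10) < Real.exp (4 / 5) := by
      have := Real.sum_le_exp_of_nonneg (show (0 : ℝ) ≤ 4 / 5 by norm_num) 4
      norm_num [Finset.sum_range_succ, Nat.factorial] at this ⊢
      linarith
    have h_log := (Real.log_lt_iff_lt_exp (by positivity)).2 h_exp
    rw [Real.log_div (by positivity) (by positivity),
      Real.log_mul (by norm_num) (by positivity), Real.log_pow, Real.log_pow] at h_log
    push_cast at h_log
    rw [h5, Real.rpow_def_of_pos (show (0 : ℝ) < 2 by norm_num),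
      Real.rpow_def_of_pos (show (0 : ℝ) < 7 by norm_num)]
    simp only [← Real.exp_add]
    rw [Real.exp_lt_one_iff]
    linarith
end
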